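/- arXiv:2501.18282 — 6 statements merged into one kernel-verified Lean document; each statement's English description precedes it below -/
import Mathlib

section
/- Minimax optimal rate for the ℓ₀-constrained estimator (Theorem 3.4): Under the sparse RUM with k ≤ d/2 and θ* ∈ Θ_{B,k}, suppose Assumption 1 (strong log-concavity with constant γ) holds and that every principal submatrix Σ_S with k ≤ |S| ≤ 2k is nonsingular. Let θ̂ be any minimizer of the negative log-likelihood ℒ over Θ_{B,k}. Then for every δ ∈ (0,1), with probability at least 1 − δ over the labels, ‖θ̂ − θ*‖_Σ² ≤ (24 ω² σ²/γ²) · (k log(d/k) + log(1/δ))/n. -/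
open Finset
open scoped BigOperators RealInnerProductSpace

noncomputable section

/-- Gram matrix `Σ = (1/n) ∑ᵢ zᵢ zᵢᵀ` of the fixed design `z`. -/
def gram {d n : ℕ} (z : Fin n → EuclideanSpace ℝ (Fin d)) : Matrix (Fin d) (Fin d) ℝ :=
  ((n : ℝ)⁻¹) • ∑ i, Matrix.vecMulVec (fun j => z i j) (fun j => z i j)

/-- The quadratic form `v ↦ vᵀ M v`; for `M = gram z` this is the squared
data-induced semi-norm `‖v‖_Σ²`. -/
def quadForm {d : ℕ} (M : Matrix (Fin d) (Fin d) ℝ) (v : EuclideanSpace ℝ (Fin d)) : ℝ :=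
  ∑ i, v i * M.mulVec (fun j => v j) i

/-- The number of non-zero coordinates, i.e. `‖θ‖₀`. -/
def l0 {d : ℕ} (θ : EuclideanSpace ℝ (Fin d)) : ℕ :=
  (Finset.univ.filter fun j => θ j ≠ 0).card

/-- Joint probability mass of the label vector `y : Fin n → Bool` under the sparse RUM
with parameter `θ` (here `y i = false` encodes `Y_i = 0`, which has probability
`F(⟨θ, z_i⟩/σ)`). -/
def rumPMF {d n : ℕ} (z : Fin n → EuclideanSpace ℝ (Fin d)) (σ : ℝ) (F : ℝ → ℝ)
    (θ : EuclideanSpace ℝ (Fin d)) (y : Fin n → Bool) : ℝ :=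
  ∏ i, if y i then 1 - F (⟪θ, z i⟫ / σ) else F (⟪θ, z i⟫ / σ)

/-- `ζ := (max_{t ∈ [0, m]} F′(t)²) / (F(m)(1 − F(m)))` with `m = BL/σ`. -/
def zeta (F : ℝ → ℝ) (m : ℝ) : ℝ :=
  sSup ((fun t => (deriv F t) ^ 2) '' Set.Icc (0 : ℝ) m) / (F m * (1 - F m))

/-- Negative log-likelihood `ℒ(θ) = −(1/n) ∑ᵢ log F((−1)^{Yᵢ} ⟨θ, zᵢ⟩/σ)`
(`y i = true` encodes `Y_i = 1`). -/
def nll {d n : ℕ} (z : Fin n → EuclideanSpace ℝ (Fin d)) (σ : ℝ) (F : ℝ → ℝ)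
    (y : Fin n → Bool) (θ : EuclideanSpace ℝ (Fin d)) : ℝ :=
  -(1 / (n : ℝ)) * ∑ i, Real.log (F ((if y i then (-1 : ℝ) else 1) * ⟪θ, z i⟫ / σ))

/-- `ω := sup_{t ∈ [−m, m]} F′(t)/F(t)` with `m = BL/σ`. -/
def omegaSup (F : ℝ → ℝ) (m : ℝ) : ℝ :=
  sSup ((fun t => deriv F t / F t) '' Set.Icc (-m) m)

open MeasureTheory

lemma sum_mul_exp_le_of_abs_le {α : Type*} [Fintype α] {p x : α → ℝ} {ω : ℝ} (hω : 0 < ω)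
    (hp0 : ∀ a, 0 ≤ p a) (hp1 : ∑ a, p a = 1) (hmean : ∑ a, p a * x a = 0)
    (hx : ∀ a, |x a| ≤ ω) (t : ℝ) :
    ∑ a, p a * Real.exp (t * x a) ≤ Real.exp (ω ^ 2 * t ^ 2 / 2) := by
  have chord (a : α) :
      Real.exp (t * x a) ≤ Real.cosh (ω * t) + Real.sinh (ω * t) / ω * x a := by
    obtain ⟨h1, h2⟩ := abs_le.1 (hx a)
    have hc := convexOn_exp.2 (Set.mem_univ (ω * t)) (Set.mem_univ (-(ω * t)))
      (show 0 ≤ (ω + x a) / (2 * ω) from div_nonneg (by linarith) (by positivity))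
      (show 0 ≤ (ω - x a) / (2 * ω) from div_nonneg (by linarith) (by positivity))
      (by field_simp; ring)
    simp only [smul_eq_mul] at hc
    have e1 : (ω + x a) / (2 * ω) * (ω * t) + (ω - x a) / (2 * ω) * -(ω * t) = t * x a := by
      field_simp; ring
    rw [e1] at hc
    refine hc.trans_eq ?_
    rw [Real.cosh_eq, Real.sinh_eq]
    field_simp; ring
  calc ∑ a, p a * Real.exp (t * x a)
      ≤ ∑ a, (Real.cosh (ω * t) * p a + Real.sinh (ω * t) / ω * (p a * x a)) := by
        refine sum_le_sum fun a _ => ?_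
        refine (mul_le_mul_of_nonneg_left (chord a) (hp0 a)).trans_eq ?_
        ring
    _ = Real.cosh (ω * t) := by
        rw [sum_add_distrib, ← mul_sum, ← mul_sum, hp1, hmean]; ring
    _ ≤ Real.exp (ω ^ 2 * t ^ 2 / 2) := by
        simpa [mul_pow] using Real.cosh_le_exp_half_sq (ω * t)

/-- A finite product of bounded, centred, finitely supported laws is sub-Gaussian. -/
lemma sum_prod_mul_exp_inner_le {ι α : Type*} [Fintype ι] [DecidableEq ι] [Fintype α]
    {p x : ι → α → ℝ} {ω : ℝ} (hω : 0 < ω)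
    (hp0 : ∀ i a, 0 ≤ p i a) (hp1 : ∀ i, ∑ a, p i a = 1) (hmean : ∀ i, ∑ a, p i a * x i a = 0)
    (hx : ∀ i a, |x i a| ≤ ω) (w : EuclideanSpace ℝ ι) :
    ∑ y : ι → α, (∏ i, p i (y i)) * Real.exp ⟪w, WithLp.toLp 2 fun i => x i (y i)⟫
      ≤ Real.exp (ω ^ 2 * ‖w‖ ^ 2 / 2) := by
  have h (y : ι → α) : (∏ i, p i (y i)) * Real.exp ⟪w, WithLp.toLp 2 fun i => x i (y i)⟫
      = ∏ i, p i (y i) * Real.exp (w i * x i (y i)) := by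
    rw [prod_mul_distrib, ← Real.exp_sum]
    simp [PiLp.inner_apply, mul_comm]
  simp_rw [h]
  rw [← Fintype.prod_sum fun i a => p i a * Real.exp (w i * x i a)]
  calc ∏ i, ∑ a, p i a * Real.exp (w i * x i a)
      ≤ ∏ i, Real.exp (ω ^ 2 * (w i) ^ 2 / 2) :=
        prod_le_prod (fun i _ => sum_nonneg fun a _ => mul_nonneg (hp0 i a) (Real.exp_pos _).le)
          fun i _ => sum_mul_exp_le_of_abs_le hω (hp0 i) (hp1 i) (hmean i) (hx i) (w i)
    _ = Real.exp (ω ^ 2 * ‖w‖ ^ 2 / 2) := by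
        rw [← Real.exp_sum, EuclideanSpace.norm_sq_eq, ← sum_div, ← mul_sum]
        simp

lemma exp_neg_sq_half_add_mul (c : ℝ) :
    (fun g : ℝ => Real.exp (-(1 / 2) * g ^ 2 + c * g))
      = fun g => Real.exp (c ^ 2 / 2) * Real.exp (-(1 / 2) * (g - c) ^ 2) := by
  funext g
  rw [← Real.exp_add]
  congr 1; ring

lemma integrable_exp_neg_sq_half_add_mul (c : ℝ) :
    Integrable fun g : ℝ => Real.exp (-(1 / 2) * g ^ 2 + c * g) := by
  rw [exp_neg_sq_half_add_mul]
  exact ((integrable_exp_neg_mul_sq (b := 1 / 2) (by norm_num)).comp_sub_right c).const_mul _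

lemma integral_exp_neg_sq_half_add_mul (c : ℝ) :
    ∫ g : ℝ, Real.exp (-(1 / 2) * g ^ 2 + c * g) = √(2 * Real.pi) * Real.exp (c ^ 2 / 2) := by
  rw [exp_neg_sq_half_add_mul, integral_const_mul,
    integral_sub_right_eq_self (fun g : ℝ => Real.exp (-(1 / 2) * g ^ 2)) c, integral_gaussian,
    mul_comm]
  congr 2; ring

/-- Exponential moment of the squared coordinates of a sub-Gaussian vector along an orthonormal
family, obtained by linearising the square with an auxiliary Gaussian integral. -/
lemma sum_prod_mul_exp_sum_inner_sq_le {ι α κ : Type*} [Fintype ι] [DecidableEq ι] [Fintype α]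
    [Fintype κ] {p x : ι → α → ℝ} {ω : ℝ} (hω : 0 < ω)
    (hp0 : ∀ i a, 0 ≤ p i a) (hp1 : ∀ i, ∑ a, p i a = 1) (hmean : ∀ i, ∑ a, p i a * x i a = 0)
    (hx : ∀ i a, |x i a| ≤ ω) {e : κ → EuclideanSpace ℝ ι} (he : Orthonormal ℝ e) :
    ∑ y : ι → α, (∏ i, p i (y i)) *
        Real.exp ((∑ j, ⟪e j, WithLp.toLp 2 fun i => x i (y i)⟫ ^ 2) / (4 * ω ^ 2))
      ≤ √2 ^ Fintype.card κ := by
  set ξ : (ι → α) → EuclideanSpace ℝ ι := fun y => WithLp.toLp 2 fun i => x i (y i)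
  set c : (ι → α) → κ → ℝ := fun y j => ⟪e j, ξ y⟫ / (√2 * ω)
  have hs2 : √2 ^ 2 = (2 : ℝ) := Real.sq_sqrt (by norm_num)
  have hlin (y : ι → α) :
      √(2 * Real.pi) ^ Fintype.card κ * Real.exp ((∑ j, ⟪e j, ξ y⟫ ^ 2) / (4 * ω ^ 2))
        = ∫ g : κ → ℝ, ∏ j, Real.exp (-(1 / 2) * g j ^ 2 + c y j * g j) := by
    rw [integral_fintype_prod_volume_eq_prod
      (fun j (t : ℝ) => Real.exp (-(1 / 2) * t ^ 2 + c y j * t))]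
    simp_rw [integral_exp_neg_sq_half_add_mul]
    rw [prod_mul_distrib, prod_const, ← Real.exp_sum, sum_div, card_univ]
    congr 2
    refine sum_congr rfl fun j _ => ?_
    simp only [c, div_pow, mul_pow, hs2]
    field_simp; ring
  have hint (y : ι → α) :
      Integrable fun g : κ → ℝ => ∏ j, Real.exp (-(1 / 2) * g j ^ 2 + c y j * g j) :=
    Integrable.fintype_prod (f := fun j (t : ℝ) => Real.exp (-(1 / 2) * t ^ 2 + c y j * t))
      fun j => integrable_exp_neg_sq_half_add_mul (c y j)
  have hpt (g : κ → ℝ) :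
      ∑ y : ι → α, (∏ i, p i (y i)) * ∏ j, Real.exp (-(1 / 2) * g j ^ 2 + c y j * g j)
        ≤ ∏ j, Real.exp (-(1 / 4) * g j ^ 2) := by
    set w : EuclideanSpace ℝ ι := (√2 * ω)⁻¹ • ∑ j, g j • e j
    have hw : ω ^ 2 * ‖w‖ ^ 2 / 2 = ∑ j, 1 / 4 * g j ^ 2 := by
      have hn : ‖∑ j, g j • e j‖ ^ 2 = ∑ j, g j ^ 2 := by
        rw [← real_inner_self_eq_norm_sq, he.inner_sum]
        simp [sq]
      rw [norm_smul, mul_pow, hn, Real.norm_eq_abs, sq_abs, inv_pow, mul_pow, hs2, ← mul_sum]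
      field_simp; ring
    have hin (y : ι → α) : ⟪w, ξ y⟫ = ∑ j, c y j * g j := by
      simp only [w, c, inner_smul_left, sum_inner, mul_sum]
      refine sum_congr rfl fun j _ => ?_
      simp only [conj_trivial]
      field_simp
    have hsplit (y : ι → α) :
        ∏ j, Real.exp (-(1 / 2) * g j ^ 2 + c y j * g j)
          = Real.exp (∑ j, -(1 / 2) * g j ^ 2) * Real.exp ⟪w, ξ y⟫ := by
      rw [← Real.exp_sum, sum_add_distrib, Real.exp_add, hin]
    simp_rw [hsplit, mul_left_comm _ (Real.exp (∑ j, -(1 / 2) * g j ^ 2))]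
    rw [← mul_sum]
    refine (mul_le_mul_of_nonneg_left
      (sum_prod_mul_exp_inner_le hω hp0 hp1 hmean hx w) (Real.exp_pos _).le).trans_eq ?_
    rw [hw, ← Real.exp_add, ← Real.exp_sum, ← sum_add_distrib]
    congr 1
    exact sum_congr rfl fun j _ => by ring
  have hgauss : ∫ g : κ → ℝ, ∏ j, Real.exp (-(1 / 4) * g j ^ 2)
      = √(2 * Real.pi) ^ Fintype.card κ * √2 ^ Fintype.card κ := by
    rw [integral_fintype_prod_volume_eq_pow (fun t : ℝ => Real.exp (-(1 / 4) * t ^ 2)),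
      integral_gaussian, ← mul_pow, ← Real.sqrt_mul (by positivity)]
    congr 2; ring
  have hpos : 0 < √(2 * Real.pi) ^ Fintype.card κ := by positivity
  refine le_of_mul_le_mul_left ?_ hpos
  rw [mul_sum, ← hgauss]
  have hswap : ∑ y : ι → α, √(2 * Real.pi) ^ Fintype.card κ *
        ((∏ i, p i (y i)) * Real.exp ((∑ j, ⟪e j, ξ y⟫ ^ 2) / (4 * ω ^ 2)))
      = ∫ g : κ → ℝ, ∑ y : ι → α,
        (∏ i, p i (y i)) * ∏ j, Real.exp (-(1 / 2) * g j ^ 2 + c y j * g j) := by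
    rw [integral_finsetSum _ fun y _ => (hint y).const_mul _]
    refine sum_congr rfl fun y _ => ?_
    rw [mul_left_comm, hlin, integral_const_mul]
  rw [hswap]
  refine integral_mono (integrable_finsetSum _ fun y _ => (hint y).const_mul _) ?_ hpt
  exact Integrable.fintype_prod (f := fun _ (t : ℝ) => Real.exp (-(1 / 4) * t ^ 2))
    fun _ => integrable_exp_neg_mul_sq (by norm_num)

lemma sum_prod_mul_exp_norm_sq_orthogonalProjectionOnto_le {ι α : Type*} [Fintype ι] [DecidableEq ι]
    [Fintype α] {p x : ι → α → ℝ} {ω : ℝ} (hω : 0 < ω)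
    (hp0 : ∀ i a, 0 ≤ p i a) (hp1 : ∀ i, ∑ a, p i a = 1) (hmean : ∀ i, ∑ a, p i a * x i a = 0)
    (hx : ∀ i a, |x i a| ≤ ω) (V : Submodule ℝ (EuclideanSpace ℝ ι)) :
    ∑ y : ι → α, (∏ i, p i (y i)) *
        Real.exp (‖V.orthogonalProjectionOnto (WithLp.toLp 2 fun i => x i (y i))‖ ^ 2 / (4 * ω ^ 2))
      ≤ √2 ^ Module.finrank ℝ V := by
  set b := stdOrthonormalBasis ℝ V
  have he : Orthonormal ℝ fun j => (b j : EuclideanSpace ℝ ι) :=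
    b.orthonormal.comp_linearIsometry V.subtypeₗᵢ
  have h := sum_prod_mul_exp_sum_inner_sq_le hω hp0 hp1 hmean hx he
  rw [Fintype.card_fin] at h
  refine le_trans (le_of_eq (sum_congr rfl fun y _ => ?_)) h
  rw [← b.sum_sq_norm_inner_right]
  congr 3
  refine sum_congr rfl fun j _ => ?_
  rw [Real.norm_eq_abs, sq_abs, Submodule.inner_orthogonalProjectionOnto_eq_of_mem_left]

/-- Union bound for the projections of a sub-Gaussian vector onto finitely many subspaces. -/
lemma sum_indicator_exists_norm_sq_orthogonalProjectionOnto_le {ι α κ : Type*} [Fintype ι]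
    [DecidableEq ι] [Fintype α] {p x : ι → α → ℝ} {ω : ℝ} (hω : 0 < ω)
    (hp0 : ∀ i a, 0 ≤ p i a) (hp1 : ∀ i, ∑ a, p i a = 1) (hmean : ∀ i, ∑ a, p i a * x i a = 0)
    (hx : ∀ i a, |x i a| ≤ ω) (K : Finset κ) (V : κ → Submodule ℝ (EuclideanSpace ℝ ι))
    {k : ℕ} (hV : ∀ S ∈ K, Module.finrank ℝ (V S) ≤ 2 * k) (t : ℝ) :
    ∑ y : ι → α, Set.indicator
        {y | ∃ S ∈ K, t < ‖(V S).orthogonalProjectionOnto (WithLp.toLp 2 fun i => x i (y i))‖ ^ 2}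
        (fun y => ∏ i, p i (y i)) y
      ≤ #K * 2 ^ k * Real.exp (-(t / (4 * ω ^ 2))) := by
  have hP (y : ι → α) : 0 ≤ ∏ i, p i (y i) := prod_nonneg fun i _ => hp0 i _
  set N : κ → (ι → α) → ℝ := fun S y =>
    ‖(V S).orthogonalProjectionOnto (WithLp.toLp 2 fun i => x i (y i))‖ ^ 2
  have hmarkov (y : ι → α) :
      Set.indicator {y | ∃ S ∈ K, t < N S y} (fun y => ∏ i, p i (y i)) y
        ≤ ∑ S ∈ K, Real.exp (-(t / (4 * ω ^ 2))) *
          ((∏ i, p i (y i)) * Real.exp (N S y / (4 * ω ^ 2))) := by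
    have hnn (S : κ) : 0 ≤ Real.exp (-(t / (4 * ω ^ 2))) *
        ((∏ i, p i (y i)) * Real.exp (N S y / (4 * ω ^ 2))) :=
      mul_nonneg (Real.exp_pos _).le (mul_nonneg (hP y) (Real.exp_pos _).le)
    refine Set.indicator_apply_le' (fun hy => ?_) fun _ => sum_nonneg fun S _ => hnn S
    obtain ⟨S, hS, hlt⟩ := hy
    refine le_trans ?_ (single_le_sum (fun S _ => hnn S) hS)
    rw [mul_left_comm, ← Real.exp_add]
    refine le_mul_of_one_le_right (hP y) (Real.one_le_exp ?_)
    rw [neg_add_eq_sub, ← sub_div]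
    exact div_nonneg (sub_nonneg.2 hlt.le) (by positivity)
  have hdim {S : κ} (hS : S ∈ K) : √2 ^ Module.finrank ℝ (V S) ≤ 2 ^ k :=
    (pow_le_pow_right₀ (Real.one_le_sqrt.2 one_le_two) (hV S hS)).trans_eq <| by
      rw [pow_mul, Real.sq_sqrt zero_le_two]
  refine (sum_le_sum fun y _ => hmarkov y).trans ?_
  rw [sum_comm]
  simp_rw [← mul_sum]
  calc Real.exp (-(t / (4 * ω ^ 2))) * ∑ S ∈ K, ∑ y : ι → α,
        (∏ i, p i (y i)) * Real.exp (N S y / (4 * ω ^ 2))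
      ≤ Real.exp (-(t / (4 * ω ^ 2))) * ∑ _S ∈ K, (2 : ℝ) ^ k := by
        gcongr with S hS
        exact (sum_prod_mul_exp_norm_sq_orthogonalProjectionOnto_le hω hp0 hp1 hmean hx (V S)).trans
          (hdim hS)
    _ = #K * 2 ^ k * Real.exp (-(t / (4 * ω ^ 2))) := by
        rw [sum_const, nsmul_eq_mul]; ring

lemma choose_two_mul_mul_two_pow_le {d k : ℕ} (hk : 2 * k ≤ d) :
    (d.choose (2 * k) : ℝ) * 2 ^ k ≤ Real.exp (6 * (k * Real.log ((d : ℝ) / k))) := by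
  rcases k.eq_zero_or_pos with rfl | hk0
  · simp
  have hkR : (0 : ℝ) < k := by exact_mod_cast hk0
  have hd : (2 : ℝ) * k ≤ d := by exact_mod_cast hk
  have hx : 2 ≤ (d : ℝ) / k := (le_div_iff₀ hkR).2 hd
  have hfact : ((2 * k : ℕ) : ℝ) ^ (2 * k) / (2 * k).factorial ≤ Real.exp (2 * k : ℕ) := by
    refine le_trans ?_ (Real.sum_le_exp_of_nonneg (Nat.cast_nonneg _) (2 * k + 1))
    exact single_le_sum (f := fun i => ((2 * k : ℕ) : ℝ) ^ i / i.factorial)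
      (fun i _ => by positivity) (self_mem_range_succ _)
  have hchoose : (d.choose (2 * k) : ℝ) ≤ (((d : ℝ) / k / 2) * Real.exp 1) ^ (2 * k) := by
    refine (Nat.choose_le_pow_div (2 * k) d).trans ?_
    rw [mul_pow, ← Real.exp_nat_mul, mul_one]
    refine le_trans (le_of_eq ?_) (mul_le_mul_of_nonneg_left hfact (by positivity))
    rw [← mul_div_assoc, ← mul_pow]
    congr 2
    push_cast
    field_simp
  have hbase : (((d : ℝ) / k / 2) * Real.exp 1) ^ 2 * 2 ≤ ((d : ℝ) / k) ^ 6 := by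
    set x := (d : ℝ) / k
    have he : Real.exp 1 ≤ 3 := Real.exp_one_lt_three.le
    have h16 : (2 : ℝ) ^ 4 ≤ x ^ 4 := by gcongr
    have he2 : Real.exp 1 ^ 2 ≤ 3 ^ 2 := by gcongr
    calc (x / 2 * Real.exp 1) ^ 2 * 2 = x ^ 2 * (Real.exp 1 ^ 2 / 2) := by ring
      _ ≤ x ^ 2 * x ^ 4 := by gcongr; linarith
      _ = x ^ 6 := by ring
  calc (d.choose (2 * k) : ℝ) * 2 ^ k
      ≤ (((d : ℝ) / k / 2) * Real.exp 1) ^ (2 * k) * 2 ^ k := by gcongr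
    _ = ((((d : ℝ) / k / 2) * Real.exp 1) ^ 2 * 2) ^ k := by rw [pow_mul, ← mul_pow]
    _ ≤ (((d : ℝ) / k) ^ 6) ^ k := by gcongr
    _ = Real.exp (6 * (k * Real.log ((d : ℝ) / k))) := by
        rw [← pow_mul, ← mul_assoc, mul_comm _ (Real.log _), Real.exp_mul,
          Real.exp_log (by positivity), ← Real.rpow_natCast]
        norm_num

lemma add_deriv_mul_add_mul_sq_le {G : ℝ → ℝ} {D : Set ℝ} (hD : Convex ℝ D) {γ : ℝ}
    (hG : ∀ t ∈ D, DifferentiableAt ℝ G t) (hG' : ∀ t ∈ D, DifferentiableAt ℝ (deriv G) t)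
    (hG'' : ∀ t ∈ D, 2 * γ ≤ deriv (deriv G) t) {u v : ℝ} (hu : u ∈ D) (hv : v ∈ D) :
    G u + deriv G u * (v - u) + γ * (v - u) ^ 2 ≤ G v := by
  set φ : ℝ → ℝ := fun t => G t - γ * t ^ 2
  have hφ {t : ℝ} (ht : t ∈ D) : HasDerivAt φ (deriv G t - 2 * γ * t) t := by
    convert! (hG t ht).hasDerivAt.sub ((hasDerivAt_pow 2 t).const_mul γ) using 1
    push_cast; ring
  have hψ {t : ℝ} (ht : t ∈ D) :
      HasDerivAt (fun t => deriv G t - 2 * γ * t) (deriv (deriv G) t - 2 * γ) t := by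
    convert! (hG' t ht).hasDerivAt.sub ((hasDerivAt_id t).const_mul (2 * γ)) using 1
    ring
  have hmono : MonotoneOn (fun t => deriv G t - 2 * γ * t) D :=
    monotoneOn_of_deriv_nonneg hD (fun t ht => (hψ ht).continuousAt.continuousWithinAt)
      (fun t ht => (hψ (interior_subset ht)).differentiableAt.differentiableWithinAt)
      fun t ht => by
        rw [(hψ (interior_subset ht)).deriv]
        exact sub_nonneg.2 (hG'' t (interior_subset ht))
  have hconv : ConvexOn ℝ D φ :=
    MonotoneOn.convexOn_of_deriv hD (fun t ht => (hφ ht).continuousAt.continuousWithinAt)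
      (fun t ht => (hφ (interior_subset ht)).differentiableAt.differentiableWithinAt)
      ((hmono.mono interior_subset).congr fun t ht => (hφ (interior_subset ht)).deriv.symm)
  have htangent : φ u + (deriv G u - 2 * γ * u) * (v - u) ≤ φ v := by
    rcases lt_trichotomy u v with h | rfl | h
    · have hs := hconv.le_slope_of_hasDerivAt hu hv h (hφ hu)
      rw [slope_def_field, le_div_iff₀ (sub_pos.2 h)] at hs
      linarith
    · simp
    · have hs := hconv.slope_le_of_hasDerivAt hv hu h (hφ hu)
      rw [slope_def_field, div_le_iff₀ (sub_pos.2 h)] at hs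
      linarith
  simp only [φ] at htangent
  linarith [htangent, show γ * (v - u) ^ 2 = γ * v ^ 2 - γ * u ^ 2 - 2 * γ * u * (v - u) by ring]

lemma hasDerivAt_neg_log {F : ℝ → ℝ} (hF : Differentiable ℝ F) {t : ℝ} (ht : 0 < F t) :
    HasDerivAt (fun s => -Real.log (F s)) (-(deriv F t / F t)) t :=
  ((hF t).hasDerivAt.log ht.ne').neg

lemma differentiableAt_deriv_neg_log {F : ℝ → ℝ} (hF : Differentiable ℝ F)
    (hF' : Differentiable ℝ (deriv F)) {t : ℝ} (ht : 0 < F t) :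
    DifferentiableAt ℝ (deriv fun s => -Real.log (F s)) t := by
  have hev : (deriv fun s => -Real.log (F s)) =ᶠ[nhds t] fun s => -(deriv F s / F s) := by
    filter_upwards [hF.continuous.continuousAt.eventually (lt_mem_nhds ht)] with s hs
    exact (hasDerivAt_neg_log hF hs).deriv
  exact (((hF' t).div (hF t) ht.ne').neg).congr_of_eventuallyEq hev

/-- Derivative in `t` of the log-probability of the label `b` when `P(b = false) = F t`. -/
def score (F : ℝ → ℝ) (t : ℝ) (b : Bool) : ℝ :=
  if b then -(deriv F (-t) / F (-t)) else deriv F t / F t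

lemma sum_prob_mul_score_eq_zero {F : ℝ → ℝ} (hFsymm : ∀ t, F t = 1 - F (-t)) {t : ℝ}
    (h0 : 0 < F t) (h1 : F t < 1) :
    ∑ b : Bool, (if b then 1 - F t else F t) * score F t b = 0 := by
  have heven : deriv F t = deriv F (-t) := by
    conv_lhs => rw [show F = fun s => 1 - F (-s) from funext hFsymm]
    rw [deriv_const_sub, deriv_comp_neg, neg_neg]
  have hneg : F (-t) = 1 - F t := by linarith [hFsymm t]
  have h1' : 1 - F t ≠ 0 := by linarith
  simp only [Fintype.sum_bool, score, if_true, Bool.false_eq_true, if_false, hneg, ← heven]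
  field_simp
  ring

lemma abs_score_le_omegaSup {F : ℝ → ℝ} {m : ℝ} (hFmono : Monotone F)
    (hF0 : ∀ t ∈ Set.Icc (-m) m, 0 < F t)
    (hbdd : BddAbove ((fun t => deriv F t / F t) '' Set.Icc (-m) m)) {t : ℝ}
    (ht : t ∈ Set.Icc (-m) m) (b : Bool) : |score F t b| ≤ omegaSup F m := by
  have key {s : ℝ} (hs : s ∈ Set.Icc (-m) m) : |deriv F s / F s| ≤ omegaSup F m := by
    rw [abs_of_nonneg (div_nonneg hFmono.deriv_nonneg (hF0 s hs).le)]
    exact le_csSup hbdd (Set.mem_image_of_mem _ hs)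
  have ht' : -t ∈ Set.Icc (-m) m := ⟨neg_le_neg ht.2, neg_le.1 ht.1⟩
  cases b
  · simpa [score] using key ht
  · simpa [score] using key ht'

lemma inner_div_mem_Icc {E : Type*} [NormedAddCommGroup E] [InnerProductSpace ℝ E] {θ z : E}
    {B L σ : ℝ} (hB : 0 ≤ B) (hσ : 0 < σ) (hθ : ‖θ‖ ≤ B) (hz : ‖z‖ ≤ L) :
    ⟪θ, z⟫ / σ ∈ Set.Icc (-(B * L / σ)) (B * L / σ) := by
  rw [Set.mem_Icc, ← abs_le, abs_div, abs_of_pos hσ]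
  gcongr
  exact (abs_real_inner_le_norm θ z).trans (mul_le_mul hθ hz (norm_nonneg z) hB)

/-- Basic inequality for an estimator at least as likely as the true parameter. -/
lemma mul_sum_sq_le_sum_score_mul {d n : ℕ} {z : Fin n → EuclideanSpace ℝ (Fin d)}
    {B L σ γ : ℝ} {F : ℝ → ℝ} (hn : 0 < n) (hB : 0 ≤ B) (hσ : 0 < σ) (hz : ∀ i, ‖z i‖ ≤ L)
    (hF0 : ∀ t ∈ Set.Icc (-(B * L / σ)) (B * L / σ), 0 < F t)
    (hF : Differentiable ℝ F) (hF' : Differentiable ℝ (deriv F))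
    (hlogccv : ∀ t ∈ Set.Icc (-(B * L / σ)) (B * L / σ),
      2 * γ ≤ deriv (deriv fun s => -Real.log (F s)) t)
    {θ₀ θ : EuclideanSpace ℝ (Fin d)} (hθ₀ : ‖θ₀‖ ≤ B) (hθ : ‖θ‖ ≤ B) {y : Fin n → Bool}
    (hle : nll z σ F y θ ≤ nll z σ F y θ₀) :
    γ * ∑ i, (⟪θ - θ₀, z i⟫ / σ) ^ 2
      ≤ ∑ i, score F (⟪θ₀, z i⟫ / σ) (y i) * (⟪θ - θ₀, z i⟫ / σ) := by
  have hterm (i : Fin n) :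
      γ * (⟪θ - θ₀, z i⟫ / σ) ^ 2
        ≤ Real.log (F ((if y i then (-1 : ℝ) else 1) * ⟪θ₀, z i⟫ / σ))
          - Real.log (F ((if y i then (-1 : ℝ) else 1) * ⟪θ, z i⟫ / σ))
          + score F (⟪θ₀, z i⟫ / σ) (y i) * (⟪θ - θ₀, z i⟫ / σ) := by
    have hu := inner_div_mem_Icc hB hσ hθ₀ (hz i)
    have hv := inner_div_mem_Icc hB hσ hθ (hz i)
    have tangent {u v : ℝ} (hu : u ∈ Set.Icc (-(B * L / σ)) (B * L / σ))
        (hv : v ∈ Set.Icc (-(B * L / σ)) (B * L / σ)) :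
        γ * (v - u) ^ 2 ≤ Real.log (F u) - Real.log (F v) + deriv F u / F u * (v - u) := by
      have h := add_deriv_mul_add_mul_sq_le (convex_Icc _ _)
        (fun t ht => (hasDerivAt_neg_log hF (hF0 t ht)).differentiableAt)
        (fun t ht => differentiableAt_deriv_neg_log hF hF' (hF0 t ht)) hlogccv hu hv
      rw [(hasDerivAt_neg_log hF (hF0 _ hu)).deriv] at h
      linarith
    rw [inner_sub_left, sub_div]
    cases y i
    · simpa [score] using tangent hu hv
    · have hneg {t : ℝ} (ht : t ∈ Set.Icc (-(B * L / σ)) (B * L / σ)) :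
          -t ∈ Set.Icc (-(B * L / σ)) (B * L / σ) := ⟨neg_le_neg ht.2, neg_le.1 ht.1⟩
      have h := tangent (hneg hu) (hneg hv)
      simp only [score, if_true, neg_one_mul, neg_div]
      linarith
  have hsum := sum_le_sum fun i (_ : i ∈ univ) => hterm i
  have hnll : (∑ i, Real.log (F ((if y i then (-1 : ℝ) else 1) * ⟪θ₀, z i⟫ / σ)))
      ≤ ∑ i, Real.log (F ((if y i then (-1 : ℝ) else 1) * ⟪θ, z i⟫ / σ)) := by
    have hn' : (0 : ℝ) < 1 / n := by positivity
    refine le_of_mul_le_mul_left ?_ hn'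
    unfold nll at hle
    linarith
  rw [← mul_sum, sum_add_distrib, sum_sub_distrib] at hsum
  linarith

lemma quadForm_gram {d n : ℕ} (z : Fin n → EuclideanSpace ℝ (Fin d))
    (v : EuclideanSpace ℝ (Fin d)) :
    quadForm (gram z) v = (n : ℝ)⁻¹ * ∑ i, ⟪v, z i⟫ ^ 2 := by
  change (fun j => v j) ⬝ᵥ (gram z).mulVec (fun j => v j) = _
  rw [gram, Matrix.smul_mulVec, dotProduct_smul, Matrix.sum_mulVec, dotProduct_sum, smul_eq_mul]
  congr 1
  refine sum_congr rfl fun i _ => ?_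
  rw [Matrix.vecMulVec_mulVec, op_smul_eq_smul, dotProduct_smul, smul_eq_mul, dotProduct_comm, sq]
  simp [PiLp.inner_apply, dotProduct, mul_comm]

/-- Span of the design columns indexed by `S`. -/
def columnSpan {d n : ℕ} (z : Fin n → EuclideanSpace ℝ (Fin d)) (S : Finset (Fin d)) :
    Submodule ℝ (EuclideanSpace ℝ (Fin n)) :=
  Submodule.span ℝ (S.image fun j => WithLp.toLp 2 fun i => z i j)

lemma finrank_columnSpan_le {d n : ℕ} (z : Fin n → EuclideanSpace ℝ (Fin d))
    (S : Finset (Fin d)) : Module.finrank ℝ (columnSpan z S) ≤ #S :=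
  (finrank_span_finset_le_card _).trans card_image_le

lemma toLp_inner_div_mem_columnSpan {d n : ℕ} (z : Fin n → EuclideanSpace ℝ (Fin d)) (σ : ℝ)
    {S : Finset (Fin d)} {v : EuclideanSpace ℝ (Fin d)} (hv : ∀ j, v j ≠ 0 → j ∈ S) :
    WithLp.toLp 2 (fun i => ⟪v, z i⟫ / σ) ∈ columnSpan z S := by
  have h : WithLp.toLp 2 (fun i => ⟪v, z i⟫ / σ)
      = ∑ j, (v j / σ) • (WithLp.toLp 2 fun i => z i j : EuclideanSpace ℝ (Fin n)) := by
    ext i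
    simp only [PiLp.inner_apply, WithLp.ofLp_sum, WithLp.ofLp_smul, Finset.sum_apply,
      Pi.smul_apply, smul_eq_mul, sum_div]
    exact sum_congr rfl fun j _ => by simp; ring
  rw [h]
  refine Submodule.sum_mem _ fun j _ => ?_
  by_cases hj : v j = 0
  · simp [hj]
  · exact Submodule.smul_mem _ _ (Submodule.subset_span (mem_image_of_mem _ (hv j hj)))

lemma exists_card_eq_support_sub_subset {d k : ℕ} (hk : 2 * k ≤ d)
    {θ θ' : EuclideanSpace ℝ (Fin d)} (hθ : l0 θ ≤ k) (hθ' : l0 θ' ≤ k) :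
    ∃ S : Finset (Fin d), #S = 2 * k ∧ ∀ j, (θ - θ') j ≠ 0 → j ∈ S := by
  classical
  obtain ⟨S, hsub, hcard⟩ := Finset.exists_superset_card_eq
    (s := (univ.filter fun j => θ j ≠ 0) ∪ univ.filter fun j => θ' j ≠ 0) (n := 2 * k)
    ((card_union_le _ _).trans (by unfold l0 at hθ hθ'; omega)) (by simpa using hk)
  refine ⟨S, hcard, fun j hj => hsub ?_⟩
  simp only [mem_union, mem_filter, mem_univ, true_and]
  by_contra! h
  exact hj (by simp [h.1, h.2])

lemma sq_mul_norm_sq_le_norm_sq_orthogonalProjectionOnto {E : Type*} [NormedAddCommGroup E]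
    [InnerProductSpace ℝ E] {V : Submodule ℝ E} [V.HasOrthogonalProjection] {γ : ℝ} (hγ : 0 ≤ γ)
    {ξ h : E} (hh : h ∈ V) (hle : γ * ‖h‖ ^ 2 ≤ ⟪ξ, h⟫) :
    γ ^ 2 * ‖h‖ ^ 2 ≤ ‖V.orthogonalProjectionOnto ξ‖ ^ 2 := by
  have hcs : γ * ‖h‖ ^ 2 ≤ ‖V.orthogonalProjectionOnto ξ‖ * ‖h‖ := by
    refine hle.trans ?_
    rw [← V.inner_orthogonalProjectionOnto_eq_of_mem_right ⟨h, hh⟩ ξ]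
    exact real_inner_le_norm _ _
  rw [← mul_pow]
  refine pow_le_pow_left₀ (by positivity) ?_ 2
  rcases (norm_nonneg h).eq_or_lt with h0 | h0
  · simp [← h0]
  · refine le_of_mul_le_mul_right ?_ h0
    linarith

/-- **Theorem 3.4 (Minimax optimal rate for the ℓ₀-constrained estimator).**
Under the sparse RUM with `k ≤ d/2`, strong log-concavity of `F` (Assumption 1),
and nonsingularity of the principal submatrices `Σ_S` for `k ≤ |S| ≤ 2k`
(Assumption 2), any minimizer `θ̂` of the negative log-likelihood over `Θ_{B,k}`
satisfies, with probability at least `1 − δ`,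
`‖θ̂ − θ*‖_Σ² ≤ (24 ω² σ²/γ²) (k log(d/k) + log(1/δ))/n`. -/
theorem l0_constrained_minimax_optimal_rate
    (d n k : ℕ) (z : Fin n → EuclideanSpace ℝ (Fin d)) (B L σ γ : ℝ) (F : ℝ → ℝ)
    (hn : 0 < n) (hB : 0 < B) (hσ : 0 < σ) (hγ : 0 < γ)
    (hz : ∀ i, ‖z i‖ ≤ L)
    (hk : 2 * k ≤ d)
    (hF01 : ∀ t ∈ Set.Icc (-(B * L / σ)) (B * L / σ), 0 < F t ∧ F t < 1)
    (hFsymm : ∀ t, F t = 1 - F (-t))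
    (hFmono : Monotone F)
    (hFdiff : Differentiable ℝ F) (hFdiff2 : Differentiable ℝ (deriv F))
    -- Assumption 1: strong log-concavity of `F` on `[−BL/σ, BL/σ]`
    (hlogccv : ∀ t ∈ Set.Icc (-(B * L / σ)) (B * L / σ),
      2 * γ ≤ deriv (deriv fun s => -Real.log (F s)) t)
    (hωbdd : BddAbove ((fun t => deriv F t / F t) '' Set.Icc (-(B * L / σ)) (B * L / σ)))
    -- Assumption 2: nonsingularity of the principal submatrices `Σ_S`, `k ≤ |S| ≤ 2k`
    (hsub : ∀ S : Finset (Fin d), k ≤ S.card → S.card ≤ 2 * k →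
      ((gram z).submatrix (fun i : {x // x ∈ S} => (i : Fin d))
          (fun i : {x // x ∈ S} => (i : Fin d))).rank = S.card)
    -- ground-truth parameter `θ* ∈ Θ_{B,k}`
    (θstar : EuclideanSpace ℝ (Fin d)) (hθB : ‖θstar‖ ≤ B) (hθ0 : l0 θstar ≤ k)
    -- `θ̂` is, for each realization of the labels, a minimizer of `ℒ` over `Θ_{B,k}`
    (θhat : (Fin n → Bool) → EuclideanSpace ℝ (Fin d))
    (hhatmem : ∀ y, ‖θhat y‖ ≤ B ∧ l0 (θhat y) ≤ k)
    (hhatmin : ∀ y, ∀ θ : EuclideanSpace ℝ (Fin d), ‖θ‖ ≤ B → l0 θ ≤ k →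
      nll z σ F y (θhat y) ≤ nll z σ F y θ)
    (δ : ℝ) (hδ0 : 0 < δ) (hδ1 : δ < 1) :
    1 - δ ≤ ∑ y, Set.indicator
        {y : Fin n → Bool |
          quadForm (gram z) (θhat y - θstar) ≤
            24 * (omegaSup F (B * L / σ)) ^ 2 * σ ^ 2 / γ ^ 2 *
              ((k * Real.log ((d : ℝ) / k) + Real.log (1 / δ)) / n)}
        (rumPMF z σ F θstar) y := by
  set ω := omegaSup F (B * L / σ)
  set T := k * Real.log ((d : ℝ) / k) + Real.log (1 / δ)
  set p : Fin n → Bool → ℝ := fun i b =>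
    if b then 1 - F (⟪θstar, z i⟫ / σ) else F (⟪θstar, z i⟫ / σ)
  set x : Fin n → Bool → ℝ := fun i b => score F (⟪θstar, z i⟫ / σ) b
  have hF0 (t : ℝ) (ht : t ∈ Set.Icc (-(B * L / σ)) (B * L / σ)) : 0 < F t := (hF01 t ht).1
  have hu (i : Fin n) := inner_div_mem_Icc hB.le hσ hθB (hz i)
  have hp0 (i : Fin n) (b : Bool) : 0 ≤ p i b := by
    obtain ⟨h0, h1⟩ := hF01 _ (hu i)
    cases b
    · simpa [p] using h0.le
    · simpa [p] using h1.le
  have hp1 (i : Fin n) : ∑ b, p i b = 1 := by simp [p]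
  have hmean (i : Fin n) : ∑ b, p i b * x i b = 0 :=
    sum_prob_mul_score_eq_zero hFsymm (hF01 _ (hu i)).1 (hF01 _ (hu i)).2
  have hx (i : Fin n) (b : Bool) : |x i b| ≤ ω :=
    abs_score_le_omegaSup hFmono hF0 hωbdd (hu i) b
  have hω0 : 0 ≤ ω := (abs_nonneg _).trans (hx ⟨0, hn⟩ true)
  have hP (y : Fin n → Bool) : 0 ≤ rumPMF z σ F θstar y := prod_nonneg fun i _ => hp0 i _
  have hP1 : ∑ y, rumPMF z σ F θstar y = 1 := by
    change ∑ y : Fin n → Bool, ∏ i, p i (y i) = 1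
    rw [← Fintype.prod_sum]
    exact prod_eq_one fun i _ => hp1 i
  set N : Finset (Fin d) → (Fin n → Bool) → ℝ := fun S y =>
    ‖(columnSpan z S).orthogonalProjectionOnto (WithLp.toLp 2 fun i => x i (y i))‖ ^ 2
  have hdet (y : Fin n → Bool) : ∃ S ∈ powersetCard (2 * k) univ,
      quadForm (gram z) (θhat y - θstar) ≤ σ ^ 2 / (n * γ ^ 2) * N S y := by
    obtain ⟨S, hcard, hS⟩ := exists_card_eq_support_sub_subset hk (hhatmem y).2 hθ0
    refine ⟨S, mem_powersetCard.2 ⟨subset_univ S, hcard⟩, ?_⟩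
    set h : EuclideanSpace ℝ (Fin n) := WithLp.toLp 2 fun i => ⟪θhat y - θstar, z i⟫ / σ
    have hnorm : ‖h‖ ^ 2 = ∑ i, (⟪θhat y - θstar, z i⟫ / σ) ^ 2 := by
      simp only [EuclideanSpace.norm_sq_eq, h, Real.norm_eq_abs, sq_abs]
    have hbasic : γ * ‖h‖ ^ 2 ≤
        ⟪(WithLp.toLp 2 fun i => x i (y i) : EuclideanSpace ℝ (Fin n)), h⟫ := by
      rw [hnorm]
      refine (mul_sum_sq_le_sum_score_mul hn hB.le hσ hz hF0 hFdiff hFdiff2 hlogccv hθB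
        (hhatmem y).1 (hhatmin y θstar hθB hθ0)).trans_eq ?_
      simp [PiLp.inner_apply, h, x, mul_comm]
    have hproj := sq_mul_norm_sq_le_norm_sq_orthogonalProjectionOnto hγ.le
      (toLp_inner_div_mem_columnSpan z σ hS) hbasic
    have hq : quadForm (gram z) (θhat y - θstar) = σ ^ 2 / (n * γ ^ 2) * (γ ^ 2 * ‖h‖ ^ 2) := by
      rw [quadForm_gram, hnorm]
      simp_rw [div_pow, ← sum_div]
      field_simp
    rw [hq]
    exact mul_le_mul_of_nonneg_left hproj (by positivity)
  set bad : Set (Fin n → Bool) := {y | ∃ S ∈ powersetCard (2 * k) univ, 24 * ω ^ 2 * T < N S y}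
  have hbad : ∑ y, bad.indicator (rumPMF z σ F θstar) y ≤ δ := by
    rcases hω0.eq_or_lt with h0 | hωpos
    · have hempty : bad = ∅ := by
        refine Set.eq_empty_of_forall_notMem fun y => ?_
        rintro ⟨S, -, hlt⟩
        have hx0 : (WithLp.toLp 2 fun i => x i (y i) : EuclideanSpace ℝ (Fin n)) = 0 := by
          ext i
          exact abs_nonpos_iff.1 ((hx i (y i)).trans h0.ge)
        simp [N, hx0, ← h0] at hlt
      simpa [hempty] using hδ0.le
    · refine (sum_indicator_exists_norm_sq_orthogonalProjectionOnto_le hωpos hp0 hp1 hmean hx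
        (powersetCard (2 * k) univ) (columnSpan z) (k := k)
        (fun S hS => (finrank_columnSpan_le z S).trans (mem_powersetCard.1 hS).2.le)
        (24 * ω ^ 2 * T)).trans ?_
      rw [card_powersetCard, card_univ, Fintype.card_fin]
      have hexp : Real.exp (-(24 * ω ^ 2 * T / (4 * ω ^ 2)))
          = Real.exp (-(6 * (k * Real.log ((d : ℝ) / k)))) * δ ^ 6 := by
        rw [← Real.exp_log (pow_pos hδ0 6), ← Real.exp_add, Real.log_pow]
        congr 1
        simp only [T, one_div, Real.log_inv]
        field_simp
        push_cast; ring
      rw [hexp]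
      calc (d.choose (2 * k) : ℝ) * 2 ^ k *
            (Real.exp (-(6 * (k * Real.log ((d : ℝ) / k)))) * δ ^ 6)
          ≤ Real.exp (6 * (k * Real.log ((d : ℝ) / k))) *
            (Real.exp (-(6 * (k * Real.log ((d : ℝ) / k)))) * δ ^ 6) := by
            gcongr
            exact choose_two_mul_mul_two_pow_le hk
        _ = δ ^ 6 := by rw [← mul_assoc, ← Real.exp_add, add_neg_cancel, Real.exp_zero, one_mul]
        _ ≤ δ := pow_le_of_le_one hδ0.le hδ1.le (by norm_num)
  have hgood (y : Fin n → Bool) :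
      rumPMF z σ F θstar y - bad.indicator (rumPMF z σ F θstar) y
        ≤ Set.indicator {y : Fin n → Bool | quadForm (gram z) (θhat y - θstar)
            ≤ 24 * ω ^ 2 * σ ^ 2 / γ ^ 2 * (T / n)} (rumPMF z σ F θstar) y := by
    by_cases hy : y ∈ bad
    · rw [Set.indicator_of_mem hy, sub_self]
      exact Set.indicator_nonneg (fun y _ => hP y) y
    · rw [Set.indicator_of_notMem hy, sub_zero, Set.indicator_of_mem]
      obtain ⟨S, hS, hle⟩ := hdet y
      have hN : N S y ≤ 24 * ω ^ 2 * T := not_lt.1 fun hlt => hy ⟨S, hS, hlt⟩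
      refine hle.trans ((mul_le_mul_of_nonneg_left hN (by positivity)).trans_eq ?_)
      field_simp
  calc 1 - δ ≤ ∑ y, (rumPMF z σ F θstar y - bad.indicator (rumPMF z σ F θstar) y) := by
        rw [sum_sub_distrib, hP1]; linarith
    _ ≤ _ := sum_le_sum fun y _ => hgood y
end
end

section
/- Upper bound for pairwise KL divergence (Lemma C.2): For any pair θ₁, θ₂ ∈ Θ_B, the Kullback–Leibler divergence between the joint laws P_{θ₁} and P_{θ₂} of the label vector (Y_1, …, Y_n) satisfies D_KL(P_{θ₁} ‖ P_{θ₂}) ≤ (n ζ/σ²) · ‖θ₁ − θ₂‖_Σ², where P_θ is the product of independent Bernoulli laws with P(Y_i = 0) = F(⟨θ, z_i⟩/σ). -/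
open Finset
open scoped BigOperators RealInnerProductSpace

noncomputable section

/-- Summing a function of one coordinate against a product of probability weights leaves
the corresponding marginal sum. -/
lemma sum_prod_mul_apply {ι κ : Type*} [Fintype ι] [DecidableEq ι] [Fintype κ]
    (a : ι → κ → ℝ) (ha : ∀ i, ∑ k, a i k = 1) (i : ι) (g : κ → ℝ) :
    ∑ y : ι → κ, (∏ j, a j (y j)) * g (y i) = ∑ k, a i k * g k := by
  have hfactor (y : ι → κ) : (∏ j, a j (y j)) * g (y i) =
      ∏ j, a j (y j) * (if j = i then g (y j) else 1) := by
    rw [Finset.prod_mul_distrib, Finset.prod_ite_eq' Finset.univ i fun j => g (y j)]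
    simp
  simp_rw [hfactor]
  rw [← Fintype.prod_sum (fun j k => a j k * if j = i then g k else 1),
    Finset.prod_eq_single i]
  · simp
  · intro j _ hj
    simp [hj, ha]
  · simp

/-- The Kullback–Leibler divergence is additive over products of finite distributions. -/
lemma sum_prod_mul_log_div_prod {ι κ : Type*} [Fintype ι] [DecidableEq ι] [Fintype κ]
    (a b : ι → κ → ℝ) (ha : ∀ i, ∑ k, a i k = 1)
    (ha0 : ∀ i k, a i k ≠ 0) (hb0 : ∀ i k, b i k ≠ 0) :
    ∑ y : ι → κ, (∏ i, a i (y i)) * Real.log ((∏ i, a i (y i)) / ∏ i, b i (y i)) =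
      ∑ i, ∑ k, a i k * Real.log (a i k / b i k) := by
  have hlog (y : ι → κ) : Real.log ((∏ i, a i (y i)) / ∏ i, b i (y i)) =
      ∑ i, Real.log (a i (y i) / b i (y i)) := by
    rw [← Finset.prod_div_distrib, Real.log_prod]
    exact fun i _ => div_ne_zero (ha0 i _) (hb0 i _)
  simp_rw [hlog, Finset.mul_sum]
  rw [Finset.sum_comm]
  exact Finset.sum_congr rfl fun i _ =>
    sum_prod_mul_apply a ha i fun k => Real.log (a i k / b i k)

/-- The Kullback–Leibler divergence between Bernoulli laws is at most their chi-square
divergence. -/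
lemma bernoulli_kl_le_chi_sq {p q : ℝ} (hp : 0 < p) (hp1 : p < 1) (hq : 0 < q) (hq1 : q < 1) :
    p * Real.log (p / q) + (1 - p) * Real.log ((1 - p) / (1 - q)) ≤
      (p - q) ^ 2 / (q * (1 - q)) := by
  have hp' : 0 < 1 - p := by linarith
  have hq' : 0 < 1 - q := by linarith
  calc p * Real.log (p / q) + (1 - p) * Real.log ((1 - p) / (1 - q))
      ≤ p * (p / q - 1) + (1 - p) * ((1 - p) / (1 - q) - 1) := by
        gcongr
        · exact Real.log_le_sub_one_of_pos (by positivity)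
        · exact Real.log_le_sub_one_of_pos (by positivity)
    _ = (p - q) ^ 2 / (q * (1 - q)) := by
        field_simp
        ring

/-- The derivative of a function symmetric about `(0, 1/2)` is even. -/
lemma deriv_neg_eq_of_symm {F : ℝ → ℝ} (hF : ∀ t, F t = 1 - F (-t)) (t : ℝ) :
    deriv F (-t) = deriv F t := by
  have h : deriv F t = deriv (fun x => 1 - F (-x)) t := congrArg (deriv · t) (funext hF)
  rw [h, deriv_const_sub, deriv_comp_neg, neg_neg]

/-- Mean value bound for a symmetric function, using its derivative on `[0, m]` only. -/
lemma sq_sub_le_sSup_deriv_sq_mul {F : ℝ → ℝ} {m s t : ℝ} (hF : Differentiable ℝ F)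
    (hFsymm : ∀ t, F t = 1 - F (-t))
    (hbdd : BddAbove ((fun t => (deriv F t) ^ 2) '' Set.Icc (0 : ℝ) m))
    (hs : |s| ≤ m) (ht : |t| ≤ m) :
    (F s - F t) ^ 2 ≤ sSup ((fun t => (deriv F t) ^ 2) '' Set.Icc (0 : ℝ) m) * (s - t) ^ 2 := by
  wlog hst : s ≤ t generalizing s t
  · have := this ht hs (le_of_not_ge hst)
    rwa [sub_sq_comm, sub_sq_comm t s] at this
  rcases hst.eq_or_lt with rfl | hlt
  · simp
  obtain ⟨c, hc, hderiv⟩ := exists_deriv_eq_slope F hlt hF.continuous.continuousOn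
    hF.differentiableOn
  have hFc : F t - F s = deriv F c * (t - s) := by
    rw [hderiv, div_mul_cancel₀ _ (sub_pos.2 hlt).ne']
  have habs : deriv F |c| = deriv F c := by
    rcases abs_choice c with h | h <;> rw [h]
    exact deriv_neg_eq_of_symm hFsymm c
  have hcm : |c| ≤ m :=
    abs_le.2 ⟨(abs_le.1 hs).1.trans hc.1.le, hc.2.le.trans (abs_le.1 ht).2⟩
  rw [sub_sq_comm, sub_sq_comm s t, hFc, mul_pow]
  gcongr
  rw [← habs]
  exact le_csSup hbdd ⟨|c|, ⟨abs_nonneg c, hcm⟩, rfl⟩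

/-- The Bernoulli variance `F (1 - F)` on `[-m, m]` is smallest at the endpoints. -/
lemma mul_one_sub_le_of_symm {F : ℝ → ℝ} {m t : ℝ} (hFmono : Monotone F)
    (hFsymm : ∀ t, F t = 1 - F (-t)) (ht : |t| ≤ m) :
    F m * (1 - F m) ≤ F t * (1 - F t) := by
  have h1 : F t ≤ F m := hFmono (abs_le.1 ht).2
  have h2 : F (-m) ≤ F t := hFmono (abs_le.1 ht).1
  have h3 := hFsymm m
  nlinarith [mul_nonneg (sub_nonneg.2 h1) (sub_nonneg.2 h2)]

/-- Each summand of the divergence is controlled by `zeta` on the interval `[-m, m]`. -/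
lemma bernoulli_kl_le_zeta_mul {F : ℝ → ℝ} {m s t : ℝ} (hF : Differentiable ℝ F)
    (hFmono : Monotone F) (hFsymm : ∀ t, F t = 1 - F (-t))
    (hFpos : 0 < F m) (hFlt : F m < 1)
    (hbdd : BddAbove ((fun t => (deriv F t) ^ 2) '' Set.Icc (0 : ℝ) m))
    (hs : |s| ≤ m) (ht : |t| ≤ m) :
    F s * Real.log (F s / F t) + (1 - F s) * Real.log ((1 - F s) / (1 - F t)) ≤
      zeta F m * (s - t) ^ 2 := by
  have hrange {u : ℝ} (hu : |u| ≤ m) : 0 < F u ∧ F u < 1 := by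
    have h1 := hFmono (abs_le.1 hu).1
    have h2 := hFmono (abs_le.1 hu).2
    have h3 := hFsymm m
    constructor <;> linarith
  obtain ⟨hs0, hs1⟩ := hrange hs
  obtain ⟨ht0, ht1⟩ := hrange ht
  have hm : 0 < F m * (1 - F m) := mul_pos hFpos (by linarith)
  calc _ ≤ (F s - F t) ^ 2 / (F t * (1 - F t)) := bernoulli_kl_le_chi_sq hs0 hs1 ht0 ht1
    _ ≤ (F s - F t) ^ 2 / (F m * (1 - F m)) := by
        exact div_le_div_of_nonneg_left (sq_nonneg _) hm
          (mul_one_sub_le_of_symm hFmono hFsymm ht)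
    _ ≤ sSup ((fun t => (deriv F t) ^ 2) '' Set.Icc (0 : ℝ) m) * (s - t) ^ 2 /
          (F m * (1 - F m)) := by
        gcongr
        exact sq_sub_le_sSup_deriv_sq_mul hF hFsymm hbdd hs ht
    _ = zeta F m * (s - t) ^ 2 := by
        rw [zeta, mul_div_right_comm]

/-- The empirical quadratic form is the sum of squared projections on the design vectors. -/
lemma natCast_mul_quadForm_gram {d n : ℕ} (z : Fin n → EuclideanSpace ℝ (Fin d))
    (v : EuclideanSpace ℝ (Fin d)) :
    (n : ℝ) * quadForm (gram z) v = ∑ i, ⟪v, z i⟫ ^ 2 := by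
  rcases Nat.eq_zero_or_pos n with rfl | hn
  · simp
  have hn0 : (n : ℝ) ≠ 0 := by positivity
  have hquad : quadForm (gram z) v = (n : ℝ)⁻¹ * ∑ i, ⟪v, z i⟫ ^ 2 := by
    change v.ofLp ⬝ᵥ (gram z).mulVec v.ofLp = _
    rw [gram, Matrix.smul_mulVec, Matrix.sum_mulVec, dotProduct_smul, dotProduct_sum, smul_eq_mul]
    congr 1
    refine Finset.sum_congr rfl fun i _ => ?_
    have hinner : ⟪v, z i⟫ = v.ofLp ⬝ᵥ (z i).ofLp := by
      simp [PiLp.inner_apply, dotProduct, mul_comm]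
    rw [Matrix.vecMulVec_mulVec, hinner, sq]
    simp [dotProduct_comm]
  rw [hquad, mul_inv_cancel_left₀ hn0]

/-- **Lemma C.2 (Upper bound for the pairwise KL divergence).**
For θ₁, θ₂ ∈ Θ_B, the KL divergence between the joint laws of the labels
`(Y₁, …, Y_n)` under the sparse RUM with parameters θ₁ and θ₂ is at most
`(n ζ/σ²) ‖θ₁ − θ₂‖_Σ²`. -/
theorem kl_divergence_upper_bound
    (d n : ℕ) (z : Fin n → EuclideanSpace ℝ (Fin d)) (B L σ : ℝ) (F : ℝ → ℝ)
    (hσ : 0 < σ) (hz : ∀ i, ‖z i‖ ≤ L)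
    (hFdiff : Differentiable ℝ F) (hFmono : Monotone F)
    (hF01 : ∀ t, 0 ≤ F t ∧ F t ≤ 1)
    (hFsymm : ∀ t, F t = 1 - F (-t))
    (hFpos : 0 < F (B * L / σ)) (hFlt : F (B * L / σ) < 1)
    (hζbdd : BddAbove ((fun t => (deriv F t) ^ 2) '' Set.Icc (0 : ℝ) (B * L / σ)))
    (θ₁ θ₂ : EuclideanSpace ℝ (Fin d)) (h₁ : ‖θ₁‖ ≤ B) (h₂ : ‖θ₂‖ ≤ B) :
    ∑ y, rumPMF z σ F θ₁ y * Real.log (rumPMF z σ F θ₁ y / rumPMF z σ F θ₂ y) ≤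
      (n : ℝ) * zeta F (B * L / σ) / σ ^ 2 * quadForm (gram z) (θ₁ - θ₂) := by
  have hbound (θ : EuclideanSpace ℝ (Fin d)) (hθ : ‖θ‖ ≤ B) (i : Fin n) :
      |⟪θ, z i⟫ / σ| ≤ B * L / σ := by
    rw [abs_div, abs_of_pos hσ]
    gcongr
    exact (abs_real_inner_le_norm θ (z i)).trans
      (mul_le_mul hθ (hz i) (norm_nonneg _) ((norm_nonneg _).trans hθ))
  have hne (θ : EuclideanSpace ℝ (Fin d)) (hθ : ‖θ‖ ≤ B) (i : Fin n) (b : Bool) :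
      (if b then 1 - F (⟪θ, z i⟫ / σ) else F (⟪θ, z i⟫ / σ)) ≠ 0 := by
    have h1 := hFmono (abs_le.1 (hbound θ hθ i)).1
    have h2 := hFmono (abs_le.1 (hbound θ hθ i)).2
    have h3 := hFsymm (B * L / σ)
    cases b
    · simpa using ne_of_gt (by linarith : 0 < F (⟪θ, z i⟫ / σ))
    · simpa using ne_of_gt (by linarith : 0 < 1 - F (⟪θ, z i⟫ / σ))
  have htensor := sum_prod_mul_log_div_prod
    (fun i (b : Bool) => if b then 1 - F (⟪θ₁, z i⟫ / σ) else F (⟪θ₁, z i⟫ / σ))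
    (fun i (b : Bool) => if b then 1 - F (⟪θ₂, z i⟫ / σ) else F (⟪θ₂, z i⟫ / σ))
    (fun i => by simp) (hne θ₁ h₁) (hne θ₂ h₂)
  calc _ = _ := htensor
    _ ≤ ∑ i, zeta F (B * L / σ) * (⟪θ₁, z i⟫ / σ - ⟪θ₂, z i⟫ / σ) ^ 2 := by
        refine Finset.sum_le_sum fun i _ => ?_
        have := bernoulli_kl_le_zeta_mul hFdiff hFmono hFsymm hFpos hFlt hζbdd
          (hbound θ₁ h₁ i) (hbound θ₂ h₂ i)
        simpa [add_comm] using this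
    _ = zeta F (B * L / σ) / σ ^ 2 * ∑ i, ⟪θ₁ - θ₂, z i⟫ ^ 2 := by
        rw [Finset.mul_sum]
        refine Finset.sum_congr rfl fun i _ => ?_
        rw [inner_sub_left, ← sub_div, div_pow]
        ring
    _ = (n : ℝ) * zeta F (B * L / σ) / σ ^ 2 * quadForm (gram z) (θ₁ - θ₂) := by
        rw [← natCast_mul_quadForm_gram]
        ring
end
end

section
/- Restricted strong convexity of the negative log-likelihood (Lemma C.3): Suppose F is twice differentiable, satisfies F(t) = 1 − F(−t), and satisfies Assumption 1 (strong log-concavity with constant γ on [−BL/σ, BL/σ]). Fix θ* ∈ Θ_B. Then for any realization of the labels Y_1, …, Y_n ∈ {0,1}, any non-empty index set S ⊂ {1,…,d}, and any θ′ ∈ ℝ^d with θ* + θ′ ∈ Θ_B, one has ℓ_S(θ* + θ′) − ℓ_S(θ*) − ⟨∇ℓ_S(θ*), θ′⟩ ≥ (γ/σ²) · ‖θ′_S‖²_{Σ_S}. -/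
open Finset
open scoped BigOperators RealInnerProductSpace

noncomputable section

/-- The restricted negative log-likelihood
`ℓ_S(θ) = −(1/n) ∑ᵢ log(1{Yᵢ=0}·F(⟨θ_S,(zᵢ)_S⟩/σ) + 1{Yᵢ=1}·F(−⟨θ_S,(zᵢ)_S⟩/σ))`
(`y i = true` encodes `Y_i = 1`). -/
def nllS {d n : ℕ} (z : Fin n → EuclideanSpace ℝ (Fin d)) (σ : ℝ) (F : ℝ → ℝ)
    (S : Finset (Fin d)) (y : Fin n → Bool) (θ : EuclideanSpace ℝ (Fin d)) : ℝ :=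
  -(1 / (n : ℝ)) * ∑ i, Real.log
    ((if y i then (0 : ℝ) else 1) * F ((∑ j ∈ S, θ j * z i j) / σ) +
      (if y i then (1 : ℝ) else 0) * F (-(∑ j ∈ S, θ j * z i j) / σ))

/-- The squared semi-norm `‖v_S‖²_{Σ_S} = (1/n) ∑ᵢ ⟨v_S, (zᵢ)_S⟩²` induced by the
principal submatrix `Σ_S`. -/
def quadFormS {d n : ℕ} (z : Fin n → EuclideanSpace ℝ (Fin d)) (S : Finset (Fin d))
    (v : EuclideanSpace ℝ (Fin d)) : ℝ :=
  (1 / (n : ℝ)) * ∑ i, (∑ j ∈ S, v j * z i j) ^ 2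

/-- A strongly convex function on an interval lies above its tangents with a quadratic gap. -/
theorem sq_le_sub_sub_of_two_mul_le_deriv2 {I : Set ℝ} (hI : Convex ℝ I) {g g' g'' : ℝ → ℝ}
    {γ : ℝ} (hg : ∀ t ∈ I, HasDerivAt g (g' t) t) (hg' : ∀ t ∈ I, HasDerivAt g' (g'' t) t)
    (hγ : ∀ t ∈ I, 2 * γ ≤ g'' t) {a b : ℝ} (ha : a ∈ I) (hb : b ∈ I) :
    γ * (b - a) ^ 2 ≤ g b - g a - g' a * (b - a) := by
  have hd : ∀ t ∈ I, HasDerivAt (fun t => g t - γ * t ^ 2) (g' t - 2 * γ * t) t := by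
    intro t ht
    refine ((hg t ht).sub ((hasDerivAt_pow 2 t).const_mul γ)).congr_deriv ?_
    norm_num
    ring
  have hd' : ∀ t ∈ I, HasDerivAt (fun t => g' t - 2 * γ * t) (g'' t - 2 * γ) t := by
    intro t ht
    exact ((hg' t ht).sub ((hasDerivAt_id t).const_mul (2 * γ))).congr_deriv (by ring)
  have hconv : ConvexOn ℝ I (fun t => g t - γ * t ^ 2) :=
    convexOn_of_hasDerivWithinAt2_nonneg hI
      (fun t ht => (hd t ht).continuousAt.continuousWithinAt)
      (fun t ht => (hd t (interior_subset ht)).hasDerivWithinAt)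
      (fun t ht => (hd' t (interior_subset ht)).hasDerivWithinAt)
      (fun t ht => sub_nonneg.2 (hγ t (interior_subset ht)))
  rcases lt_trichotomy a b with hab | rfl | hab
  · have h := hconv.le_slope_of_hasDerivAt ha hb hab (hd a ha)
    rw [slope_def_field, le_div_iff₀ (sub_pos.2 hab)] at h
    linarith
  · simp
  · have h := hconv.slope_le_of_hasDerivAt hb ha hab (hd a ha)
    rw [slope_def_field, div_le_iff₀ (sub_pos.2 hab)] at h
    linarith

/-- Quadratic lower bound on the Bregman divergence of `-log F` for strongly log-concave `F`. -/
theorem sq_le_neg_log_bregman {I : Set ℝ} (hI : Convex ℝ I) {F : ℝ → ℝ} {γ : ℝ}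
    (hF : Differentiable ℝ F) (hF' : Differentiable ℝ (deriv F)) (hpos : ∀ t ∈ I, 0 < F t)
    (hγ : ∀ t ∈ I, 2 * γ ≤ deriv (deriv fun s => -Real.log (F s)) t)
    {a b : ℝ} (ha : a ∈ I) (hb : b ∈ I) :
    γ * (b - a) ^ 2 ≤
      -Real.log (F b) - -Real.log (F a) - -(deriv F a / F a) * (b - a) := by
  have hd : ∀ t, 0 < F t →
      HasDerivAt (fun s => -Real.log (F s)) (-(deriv F t / F t)) t := fun t ht =>
    ((hF t).hasDerivAt.log ht.ne').neg
  refine sq_le_sub_sub_of_two_mul_le_deriv2 hI (g := fun s => -Real.log (F s))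
    (g' := fun t => -(deriv F t / F t)) (fun t ht => hd t (hpos t ht)) (fun t ht => ?_) hγ ha hb
  have heq : (deriv fun s => -Real.log (F s)) =ᶠ[nhds t] fun t => -(deriv F t / F t) := by
    filter_upwards [hF.continuous.continuousAt.eventually (lt_mem_nhds (hpos t ht))] with s hs
    exact (hd s hs).deriv
  rw [heq.deriv_eq]
  exact (((hF' t).div (hF t) (hpos t ht).ne').neg).hasDerivAt

/-- Cauchy–Schwarz for the restriction of two Euclidean vectors to a set of coordinates. -/
theorem abs_sum_mul_le_norm_mul_norm {ι : Type*} [Fintype ι] (S : Finset ι)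
    (x w : EuclideanSpace ℝ ι) : |∑ j ∈ S, x j * w j| ≤ ‖x‖ * ‖w‖ := by
  refine abs_le_of_sq_le_sq ?_ (by positivity)
  have hle : ∀ v : EuclideanSpace ℝ ι, ∑ j ∈ S, v j ^ 2 ≤ ‖v‖ ^ 2 := fun v => by
    rw [EuclideanSpace.real_norm_sq_eq]
    exact Finset.sum_le_sum_of_subset_of_nonneg (Finset.subset_univ S)
      (fun _ _ _ => sq_nonneg _)
  rw [mul_pow]
  exact (Finset.sum_mul_sq_le_sq_mul_sq S _ _).trans
    (mul_le_mul (hle x) (hle w) (Finset.sum_nonneg fun _ _ => sq_nonneg _) (sq_nonneg _))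

/-- The functional `θ ↦ ±⟨θ_S, w_S⟩ / σ`, with sign `-` for the label `true`. -/
def signedScore {d : ℕ} (w : EuclideanSpace ℝ (Fin d)) (σ : ℝ) (S : Finset (Fin d)) (b : Bool) :
    EuclideanSpace ℝ (Fin d) →L[ℝ] ℝ :=
  ((if b then (-1 : ℝ) else 1) / σ) • ∑ j ∈ S, w j • EuclideanSpace.proj j

theorem signedScore_apply {d : ℕ} (w : EuclideanSpace ℝ (Fin d)) (σ : ℝ) (S : Finset (Fin d))
    (b : Bool) (θ : EuclideanSpace ℝ (Fin d)) :
    signedScore w σ S b θ = (if b then (-1 : ℝ) else 1) / σ * ∑ j ∈ S, θ j * w j := by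
  simp [signedScore, mul_comm]

theorem signedScore_sq {d : ℕ} (w : EuclideanSpace ℝ (Fin d)) (σ : ℝ) (S : Finset (Fin d))
    (b : Bool) (θ : EuclideanSpace ℝ (Fin d)) :
    signedScore w σ S b θ ^ 2 = (∑ j ∈ S, θ j * w j) ^ 2 / σ ^ 2 := by
  rw [signedScore_apply]
  cases b <;> simp <;> ring

theorem signedScore_mem_Icc {d : ℕ} {w θ : EuclideanSpace ℝ (Fin d)} {B L σ : ℝ} (hσ : 0 < σ)
    (S : Finset (Fin d)) (b : Bool) (hw : ‖w‖ ≤ L) (hθ : ‖θ‖ ≤ B) :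
    signedScore w σ S b θ ∈ Set.Icc (-(B * L / σ)) (B * L / σ) := by
  have h : |∑ j ∈ S, θ j * w j| ≤ B * L :=
    (abs_sum_mul_le_norm_mul_norm S θ w).trans
      (mul_le_mul hθ hw (norm_nonneg _) ((norm_nonneg _).trans hθ))
  rw [Set.mem_Icc, ← abs_le, signedScore_apply, abs_mul, abs_div, abs_of_pos hσ, div_mul_eq_mul_div]
  refine div_le_div_of_nonneg_right ?_ hσ.le
  cases b <;> simpa using h

theorem nllS_eq_sum_signedScore {d n : ℕ} (z : Fin n → EuclideanSpace ℝ (Fin d)) (σ : ℝ)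
    (F : ℝ → ℝ) (S : Finset (Fin d)) (y : Fin n → Bool) :
    nllS z σ F S y =
      fun θ => (1 / (n : ℝ)) * ∑ i, -Real.log (F (signedScore (z i) σ S (y i) θ)) := by
  funext θ
  rw [nllS, Finset.sum_neg_distrib, neg_mul, mul_neg]
  congr 2
  refine Finset.sum_congr rfl fun i _ => ?_
  rw [signedScore_apply]
  cases y i <;> simp [div_eq_inv_mul]

theorem inner_gradient_nllS {d n : ℕ} (z : Fin n → EuclideanSpace ℝ (Fin d)) (σ : ℝ)
    {F : ℝ → ℝ} (hF : Differentiable ℝ F) (S : Finset (Fin d)) (y : Fin n → Bool)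
    (θ v : EuclideanSpace ℝ (Fin d)) (hpos : ∀ i, 0 < F (signedScore (z i) σ S (y i) θ)) :
    ⟪gradient (nllS z σ F S y) θ, v⟫ = (1 / (n : ℝ)) * ∑ i,
      -(deriv F (signedScore (z i) σ S (y i) θ) / F (signedScore (z i) σ S (y i) θ)) *
        signedScore (z i) σ S (y i) v := by
  have h : HasFDerivAt (nllS z σ F S y) ((1 / (n : ℝ)) • ∑ i,
      (-(deriv F (signedScore (z i) σ S (y i) θ) / F (signedScore (z i) σ S (y i) θ))) •
        signedScore (z i) σ S (y i)) θ := by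
    rw [nllS_eq_sum_signedScore]
    refine (HasFDerivAt.fun_sum fun i _ => ?_).const_mul _
    have hg := ((hF (signedScore (z i) σ S (y i) θ)).hasDerivAt.log (hpos i).ne').neg
    exact hg.comp_hasFDerivAt θ (signedScore (z i) σ S (y i)).hasFDerivAt
  rw [gradient, InnerProductSpace.toDual_symm_apply, h.fderiv]
  simp

/-- **Lemma C.3 (Restricted strong convexity of the negative log-likelihood).**
If `F` is strongly log-concave on `[−BL/σ, BL/σ]` with constant `γ`, then for any
label realization, any non-empty index set `S`, and any `θ′` with `θ* + θ′ ∈ Θ_B`,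
`ℓ_S(θ* + θ′) − ℓ_S(θ*) − ⟨∇ℓ_S(θ*), θ′⟩ ≥ (γ/σ²)‖θ′_S‖²_{Σ_S}`. -/
theorem restricted_strong_convexity
    (d n : ℕ) (z : Fin n → EuclideanSpace ℝ (Fin d)) (B L σ γ : ℝ) (F : ℝ → ℝ)
    (hσ : 0 < σ) (hγ : 0 < γ) (hz : ∀ i, ‖z i‖ ≤ L)
    (hFdiff : Differentiable ℝ F) (hFdiff2 : Differentiable ℝ (deriv F))
    (hFsymm : ∀ t, F t = 1 - F (-t))
    (hF01 : ∀ t ∈ Set.Icc (-(B * L / σ)) (B * L / σ), 0 < F t ∧ F t < 1)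
    -- Assumption 1: strong log-concavity of `F` on `[−BL/σ, BL/σ]`
    (hlogccv : ∀ t ∈ Set.Icc (-(B * L / σ)) (B * L / σ),
      2 * γ ≤ deriv (deriv fun s => -Real.log (F s)) t)
    (θstar : EuclideanSpace ℝ (Fin d)) (hθB : ‖θstar‖ ≤ B)
    (y : Fin n → Bool)
    (S : Finset (Fin d)) (hS : S.Nonempty)
    (θ' : EuclideanSpace ℝ (Fin d)) (hθ' : ‖θstar + θ'‖ ≤ B) :
    γ / σ ^ 2 * quadFormS z S θ' ≤
      nllS z σ F S y (θstar + θ') - nllS z σ F S y θstar -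
        ⟪gradient (nllS z σ F S y) θstar, θ'⟫ := by
  have hmem : ∀ i (θ : EuclideanSpace ℝ (Fin d)), ‖θ‖ ≤ B →
      signedScore (z i) σ S (y i) θ ∈ Set.Icc (-(B * L / σ)) (B * L / σ) :=
    fun i _ hθ => signedScore_mem_Icc hσ S (y i) (hz i) hθ
  rw [inner_gradient_nllS z σ hFdiff S y θstar θ' fun i => (hF01 _ (hmem i _ hθB)).1,
    nllS_eq_sum_signedScore, quadFormS]
  rw [mul_left_comm, ← mul_sub, ← mul_sub, ← Finset.sum_sub_distrib, ← Finset.sum_sub_distrib,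
    Finset.mul_sum]
  refine mul_le_mul_of_nonneg_left (Finset.sum_le_sum fun i _ => ?_) (by positivity)
  have h := sq_le_neg_log_bregman (convex_Icc _ _) hFdiff hFdiff2 (fun t ht => (hF01 t ht).1)
    hlogccv (hmem i _ hθB) (hmem i _ hθ')
  rw [← map_sub, add_sub_cancel_left, signedScore_sq] at h
  calc γ / σ ^ 2 * (∑ j ∈ S, θ' j * z i j) ^ 2
      = γ * ((∑ j ∈ S, θ' j * z i j) ^ 2 / σ ^ 2) := by ring
    _ ≤ _ := h
end
end

section
/- Sparse Varshamov–Gilbert bound (Lemma C.1): For any two integers k and d with 1 ≤ k ≤ d/8, there exist binary vectors w_1, …, w_M ∈ {0,1}^d such that (i) the Hamming distance between any two distinct w_i and w_j is at least k/2; (ii) log M ≥ (k/8) log(1 + d/(2k)); and (iii) every w_j has exactly k non-zero coordinates. -/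
open Finset

/-- A finite set contains a maximal subset whose distinct elements are pairwise unrelated; every
element is then related to a member of that subset. -/
theorem exists_pairwise_not_and_forall_exists_rel {α : Type*} [DecidableEq α]
    (r : α → α → Prop) (hsymm : ∀ a b, r a b → r b a) (s : Finset α) (hrefl : ∀ a ∈ s, r a a) :
    ∃ t ⊆ s, (∀ a ∈ t, ∀ b ∈ t, a ≠ b → ¬ r a b) ∧ ∀ a ∈ s, ∃ b ∈ t, r a b := by
  classical
  obtain ⟨t, ht, hmax⟩ := Finset.exists_max_image
    (s.powerset.filter fun t => ∀ a ∈ t, ∀ b ∈ t, a ≠ b → ¬ r a b) Finset.card ⟨∅, by simp⟩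
  simp only [mem_filter, mem_powerset] at ht hmax
  refine ⟨t, ht.1, ht.2, fun a ha => ?_⟩
  by_contra! hcon
  have hat : a ∉ t := fun h => hcon a h (hrefl a ha)
  have hle := hmax (insert a t) ⟨insert_subset ha ht.1, fun x hx y hy hxy => by
    rcases mem_insert.1 hx with rfl | hxt <;> rcases mem_insert.1 hy with rfl | hyt
    · exact absurd rfl hxy
    · exact hcon y hyt
    · exact fun h => hcon x hxt (hsymm _ _ h)
    · exact ht.2 x hxt y hyt hxy⟩
  rw [card_insert_of_notMem hat] at hle
  omega

/-- The number of `k`-subsets meeting `B` in at least `m` points is at most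
`C(|B|, m) * C(d - m, k - m)`. -/
theorem card_filter_le_card_inter_le {α : Type*} [Fintype α] [DecidableEq α]
    (k m : ℕ) (B : Finset α) :
    ((powersetCard k (univ : Finset α)).filter fun A => m ≤ (A ∩ B).card).card ≤
      B.card.choose m * (Fintype.card α - m).choose (k - m) := by
  have hsub : ((powersetCard k (univ : Finset α)).filter fun A => m ≤ (A ∩ B).card) ⊆
      (powersetCard m B).biUnion fun S => (powersetCard (k - m) Sᶜ).image (S ∪ ·) := by
    intro A hA
    simp only [mem_filter, mem_powersetCard, subset_univ, true_and] at hA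
    obtain ⟨S, hS, hSm⟩ := exists_subset_card_eq hA.2
    have hSA : S ⊆ A := hS.trans inter_subset_left
    simp only [mem_biUnion, mem_image, mem_powersetCard]
    refine ⟨S, ⟨hS.trans inter_subset_right, hSm⟩, A \ S, ⟨?_, ?_⟩, union_sdiff_of_subset hSA⟩
    · intro x hx
      simpa using (mem_sdiff.1 hx).2
    · rw [card_sdiff_of_subset hSA, hA.1, hSm]
  refine (card_le_card hsub).trans ?_
  rw [← card_powersetCard m B]
  refine card_biUnion_le_card_mul _ _ _ fun S hS => card_image_le.trans ?_
  rw [card_powersetCard, card_compl, (mem_powersetCard.1 hS).2]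

theorem pow_mul_descFactorial_le {k d : ℕ} (hkd : k ≤ d) (m : ℕ) :
    d ^ m * k.descFactorial m ≤ k ^ m * d.descFactorial m := by
  induction m with
  | zero => simp
  | succ m ih =>
    have h : d * (k - m) ≤ k * (d - m) := by
      rw [Nat.mul_sub, Nat.mul_sub, mul_comm d k]
      exact Nat.sub_le_sub_left (Nat.mul_le_mul_right m hkd) _
    calc d ^ (m + 1) * k.descFactorial (m + 1)
        = (d * (k - m)) * (d ^ m * k.descFactorial m) := by
          rw [Nat.descFactorial_succ]; ring
      _ ≤ (k * (d - m)) * (k ^ m * d.descFactorial m) := Nat.mul_le_mul h ih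
      _ = k ^ (m + 1) * d.descFactorial (m + 1) := by
          rw [Nat.descFactorial_succ]; ring

theorem pow_mul_choose_le {k d : ℕ} (hkd : k ≤ d) (m : ℕ) :
    d ^ m * k.choose m ≤ k ^ m * d.choose m := by
  have h := pow_mul_descFactorial_le hkd m
  rw [Nat.descFactorial_eq_factorial_mul_choose, Nat.descFactorial_eq_factorial_mul_choose] at h
  refine Nat.le_of_mul_le_mul_left ?_ (Nat.factorial_pos m)
  linarith

/-- There is a family of `k`-subsets of a finite type, pairwise meeting in fewer than `m` points,
with at least `(d / k) ^ m / 2 ^ k` members, where `d` is the size of the type. -/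
theorem exists_family_card_inter_lt {α : Type*} [Fintype α] [DecidableEq α] {k m : ℕ}
    (hmk : m ≤ k) (hkd : k ≤ Fintype.card α) :
    ∃ F ⊆ powersetCard k (univ : Finset α),
      (∀ A ∈ F, ∀ B ∈ F, A ≠ B → (A ∩ B).card < m) ∧
      Fintype.card α ^ m ≤ F.card * 2 ^ k * k ^ m := by
  obtain ⟨F, hF, hpair, hcover⟩ := exists_pairwise_not_and_forall_exists_rel
    (fun A B : Finset α => m ≤ (A ∩ B).card) (fun A B h => by rwa [inter_comm])
    (powersetCard k univ) (fun A hA => by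
      rw [inter_self, (mem_powersetCard.1 hA).2]
      exact hmk)
  refine ⟨F, hF, fun A hA B hB hAB => not_le.1 (hpair A hA B hB hAB), ?_⟩
  set d := Fintype.card α
  have hcount : d.choose k ≤ F.card * (k.choose m * (d - m).choose (k - m)) := by
    have hsub : powersetCard k (univ : Finset α) ⊆ F.biUnion fun B =>
        (powersetCard k (univ : Finset α)).filter fun A => m ≤ (A ∩ B).card := by
      intro A hA
      obtain ⟨B, hB, hAB⟩ := hcover A hA
      exact mem_biUnion.2 ⟨B, hB, mem_filter.2 ⟨hA, hAB⟩⟩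
    have h := card_le_card hsub
    rw [card_powersetCard, card_univ] at h
    refine h.trans (card_biUnion_le_card_mul _ _ _ fun B hB => ?_)
    have hB' := card_filter_le_card_inter_le k m B
    rwa [(mem_powersetCard.1 (hF hB)).2] at hB'
  have hc : 0 < k.choose m := Nat.choose_pos hmk
  have hc' : 0 < (d - m).choose (k - m) := Nat.choose_pos (by omega)
  have hdm : d.choose m ≤ F.card * k.choose m * k.choose m := by
    refine Nat.le_of_mul_le_mul_right ?_ hc'
    rw [← Nat.choose_mul hmk]
    calc d.choose k * k.choose m
        ≤ F.card * (k.choose m * (d - m).choose (k - m)) * k.choose m :=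
          Nat.mul_le_mul_right _ hcount
      _ = _ := by ring
  have hpow : d ^ m ≤ F.card * k.choose m * k ^ m := by
    refine Nat.le_of_mul_le_mul_right ?_ hc
    calc d ^ m * k.choose m ≤ k ^ m * d.choose m := pow_mul_choose_le hkd m
      _ ≤ k ^ m * (F.card * k.choose m * k.choose m) := Nat.mul_le_mul_left _ hdm
      _ = _ := by ring
  refine hpow.trans ?_
  gcongr
  exact Nat.choose_le_two_pow k m

theorem hammingDist_decide_mem {α : Type*} [Fintype α] [DecidableEq α] (A B : Finset α) :
    hammingDist (fun x => decide (x ∈ A)) (fun x => decide (x ∈ B)) + 2 * (A ∩ B).card =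
      A.card + B.card := by
  have h : hammingDist (fun x => decide (x ∈ A)) (fun x => decide (x ∈ B)) =
      (A \ B).card + (B \ A).card := by
    rw [← card_union_of_disjoint (disjoint_sdiff_sdiff), hammingDist]
    congr 1
    ext x
    by_cases hA : x ∈ A <;> by_cases hB : x ∈ B <;> simp [hA, hB]
  have hA := card_sdiff_add_card_inter A B
  have hB := card_sdiff_add_card_inter B A
  rw [inter_comm] at hB
  omega

theorem log_le_log_of_pow_le {k d m M : ℕ} (hk : 1 ≤ k) (hkd : 8 * k ≤ d) (hm : 3 * k ≤ 4 * m)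
    (h : d ^ m ≤ M * 2 ^ k * k ^ m) :
    (k : ℝ) / 8 * Real.log (1 + (d : ℝ) / (2 * k)) ≤ Real.log M := by
  have hk0 : (0 : ℝ) < k := by exact_mod_cast hk
  have hkd' : 8 * (k : ℝ) ≤ d := by exact_mod_cast hkd
  have hd0 : (0 : ℝ) < d := by linarith
  have hm' : 3 * (k : ℝ) ≤ 4 * m := by exact_mod_cast hm
  have hM : (0 : ℝ) < M := by
    rcases Nat.eq_zero_or_pos M with rfl | hM
    · have : 0 < d ^ m := Nat.pow_pos (by omega)
      omega
    · exact_mod_cast hM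
  have hlog : m * Real.log d ≤ Real.log M + k * Real.log 2 + m * Real.log k := by
    have h' : (d : ℝ) ^ m ≤ M * 2 ^ k * k ^ m := by exact_mod_cast h
    have := Real.log_le_log (by positivity) h'
    rwa [Real.log_mul (by positivity) (by positivity), Real.log_mul (by positivity) (by positivity),
      Real.log_pow, Real.log_pow, Real.log_pow] at this
  have hratio : 8 ≤ (d : ℝ) / k := (le_div_iff₀ hk0).2 hkd'
  have hL : Real.log (d / k) = Real.log d - Real.log k := Real.log_div hd0.ne' hk0.ne'
  have hL8 : 3 * Real.log 2 ≤ Real.log ((d : ℝ) / k) := by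
    have := Real.log_le_log (by norm_num) hratio
    rwa [show (8 : ℝ) = 2 ^ 3 by norm_num, Real.log_pow] at this
  have hle : Real.log (1 + (d : ℝ) / (2 * k)) ≤ Real.log ((d : ℝ) / k) := by
    refine Real.log_le_log (by positivity) ?_
    have : (d : ℝ) / (2 * k) = d / k / 2 := by field_simp
    linarith
  have h2 : 0 < Real.log 2 := Real.log_pos one_lt_two
  set L := Real.log ((d : ℝ) / k)
  have h₁ : (k : ℝ) / 8 * Real.log (1 + (d : ℝ) / (2 * k)) ≤ k / 8 * L := by gcongr
  have h₂ : 3 * (k : ℝ) * L ≤ 4 * m * L := mul_le_mul_of_nonneg_right hm' (by linarith)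
  have h₃ : k * (3 * Real.log 2) ≤ k * L := by gcongr
  have h₄ : 0 ≤ k * Real.log 2 := by positivity
  have h₅ : m * L = m * Real.log d - m * Real.log k := by rw [hL]; ring
  linarith

/-- **Lemma C.1 (Sparse Varshamov–Gilbert bound).** For integers `1 ≤ k ≤ d/8`
there exist binary vectors `w_1, …, w_M ∈ {0,1}^d` such that (i) any two distinct
vectors are at Hamming distance at least `k/2`; (ii) `log M ≥ (k/8) log(1 + d/(2k))`;
and (iii) every `w_j` has exactly `k` non-zero coordinates. -/
theorem sparse_varshamov_gilbert (k d : ℕ) (hk : 1 ≤ k) (hkd : 8 * k ≤ d) :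
    ∃ (M : ℕ) (w : Fin M → (Fin d → Bool)),
      (∀ i j, i ≠ j → (k : ℝ) / 2 ≤ (hammingDist (w i) (w j) : ℝ)) ∧
      ((k : ℝ) / 8 * Real.log (1 + (d : ℝ) / (2 * k)) ≤ Real.log M) ∧
      (∀ j, (Finset.univ.filter fun x => w j x = true).card = k) := by
  obtain ⟨F, hF, hpair, hcard⟩ := exists_family_card_inter_lt (α := Fin d) (k := k)
    (m := 3 * k / 4 + 1) (by omega) (by rw [Fintype.card_fin]; omega)
  rw [Fintype.card_fin] at hcard
  have hFk : ∀ A : F, (A : Finset (Fin d)).card = k := fun A => (mem_powersetCard.1 (hF A.2)).2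
  refine ⟨F.card, fun j x => decide (x ∈ (F.equivFin.symm j : Finset (Fin d))),
    fun i j hij => ?_, log_le_log_of_pow_le hk hkd (by omega) hcard, fun j => ?_⟩
  · have hne : (F.equivFin.symm i : Finset (Fin d)) ≠ F.equivFin.symm j := fun h =>
      hij (F.equivFin.symm.injective (Subtype.ext h))
    have hlt := hpair _ (F.equivFin.symm i).2 _ (F.equivFin.symm j).2 hne
    have hdist := hammingDist_decide_mem (F.equivFin.symm i : Finset (Fin d)) (F.equivFin.symm j)
    rw [hFk, hFk] at hdist
    rw [div_le_iff₀ two_pos]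
    dsimp only
    norm_cast
    omega
  · simpa using hFk (F.equivFin.symm j)
end

section
/- Bernstein's inequality for sub-Gaussian vectors in quadratic form (Lemma C.6): Let A be a real matrix with n columns and set Σ = Aᵀ A. Suppose x = (x_1, …, x_n) is a random vector such that for some μ ∈ ℝ^n and σ ≥ 0, E[exp(αᵀ(x − μ))] ≤ exp(‖α‖₂² σ²/2) for all α ∈ ℝ^n. Then for any t > 0, P[ ‖Ax‖² > σ²(tr(Σ) + 2√(tr(Σ²) t) + 2‖Σ‖₂ t) + tr(Σ μ μᵀ)(1 + 2(‖Σ‖₂² t/tr(Σ²))^{1/2}) ] ≤ e^{−t}. -/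
open MeasureTheory Finset Matrix
open scoped ENNReal

noncomputable section

/-- The spectral norm (largest singular value) of a square real matrix, realized as
the operator norm of the associated continuous linear map on Euclidean space. -/
def specNorm {n : ℕ} (M : Matrix (Fin n) (Fin n) ℝ) : ℝ :=
  ‖Matrix.toEuclideanCLM (𝕜 := ℝ) M‖

open ProbabilityTheory

lemma inv_sqrt_one_sub_le_exp {a : ℝ} (ha : 0 ≤ a) (ha' : 2 * a < 1) :
    (√(1 - 2 * a))⁻¹ ≤ Real.exp (a + a ^ 2 / (1 - 2 * a)) := by
  have hq : 0 < 1 - 2 * a := by linarith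
  have hlog : Real.log (1 - 2 * a) ≤ 0 := Real.log_nonpos hq.le (by linarith)
  have hs := Real.self_le_sinh_iff.2 (neg_nonneg.2 hlog)
  rw [Real.sinh_eq, neg_neg, Real.exp_neg, Real.exp_log hq] at hs
  have hl : (√(1 - 2 * a))⁻¹ = Real.exp (-(Real.log (1 - 2 * a) / 2)) := by
    rw [Real.exp_neg, ← Real.log_sqrt hq.le, Real.exp_log (Real.sqrt_pos.2 hq)]
  rw [hl, Real.exp_le_exp]
  have : a + a ^ 2 / (1 - 2 * a) = ((1 - 2 * a)⁻¹ - (1 - 2 * a)) / 4 := by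
    linear_combination ((1 - 2 * a) / 4 - 1 / 2) * inv_mul_cancel₀ hq.ne'
  linarith

/-- The Laplace transform of a quadratic polynomial of a standard Gaussian variable. -/
lemma lintegral_exp_quadratic_gaussianReal (c : ℝ) {a : ℝ} (ha : 2 * a < 1) :
    ∫⁻ z, ENNReal.ofReal (Real.exp (c * z + a * z ^ 2)) ∂gaussianReal 0 1 =
      ENNReal.ofReal ((√(1 - 2 * a))⁻¹ * Real.exp (c ^ 2 / (2 * (1 - 2 * a)))) := by
  have hq : 0 < 1 - 2 * a := by linarith
  obtain ⟨v, hv⟩ : ∃ v : NNReal, (v : ℝ) = (1 - 2 * a)⁻¹ := ⟨⟨_, (inv_pos.2 hq).le⟩, rfl⟩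
  have hv0 : v ≠ 0 := by
    intro h
    rw [h, NNReal.coe_zero] at hv
    exact (inv_pos.2 hq).ne hv
  rw [gaussianReal_of_var_ne_zero _ one_ne_zero,
    lintegral_withDensity_eq_lintegral_mul _ (measurable_gaussianPDF _ _) (by fun_prop)]
  have key : ∀ z : ℝ, (gaussianPDF 0 1 * fun z ↦ ENNReal.ofReal (Real.exp (c * z + a * z ^ 2))) z =
      ENNReal.ofReal ((√(1 - 2 * a))⁻¹ * Real.exp (c ^ 2 / (2 * (1 - 2 * a)))) *
        gaussianPDF (c / (1 - 2 * a)) v z := by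
    intro z
    rw [Pi.mul_apply, gaussianPDF, gaussianPDF, ← ENNReal.ofReal_mul (gaussianPDFReal_nonneg _ _ _),
      ← ENNReal.ofReal_mul (by positivity)]
    congr 1
    rw [gaussianPDFReal, gaussianPDFReal, hv]
    have h1 : √(2 * Real.pi * (1 - 2 * a)⁻¹) = √(2 * Real.pi) * (√(1 - 2 * a))⁻¹ := by
      rw [Real.sqrt_mul (by positivity), Real.sqrt_inv]
    have h2 : -(z - 0) ^ 2 / (2 * ((1 : NNReal) : ℝ)) + (c * z + a * z ^ 2) =
        c ^ 2 / (2 * (1 - 2 * a)) + -(z - c / (1 - 2 * a)) ^ 2 / (2 * (1 - 2 * a)⁻¹) := by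
      push_cast
      field_simp
      ring
    have h3 : 0 < √(1 - 2 * a) := Real.sqrt_pos.2 hq
    rw [mul_assoc, ← Real.exp_add, h2, Real.exp_add, h1]
    push_cast
    rw [mul_one]
    field_simp
  rw [lintegral_congr key, lintegral_const_mul _ (measurable_gaussianPDF _ _),
    lintegral_gaussianPDF_eq_one _ hv0, mul_one]

lemma lintegral_exp_quadratic_pi_gaussianReal {ι : Type*} [Fintype ι] (c a : ι → ℝ)
    (ha : ∀ i, 2 * a i < 1) :
    ∫⁻ z, ENNReal.ofReal (Real.exp (∑ i, (c i * z i + a i * z i ^ 2)))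
        ∂Measure.pi (fun _ : ι ↦ gaussianReal 0 1) =
      ENNReal.ofReal (∏ i, (√(1 - 2 * a i))⁻¹ * Real.exp (c i ^ 2 / (2 * (1 - 2 * a i)))) := by
  have hind : iIndepFun (fun i (z : ι → ℝ) ↦
      ENNReal.ofReal (Real.exp (c i * z i + a i * z i ^ 2)))
      (Measure.pi (fun _ : ι ↦ gaussianReal 0 1)) :=
    iIndepFun_pi (X := fun i z ↦ ENNReal.ofReal (Real.exp (c i * z + a i * z ^ 2)))
      fun i ↦ by fun_prop
  simp_rw [Real.exp_sum, ENNReal.ofReal_prod_of_nonneg fun i _ ↦ (Real.exp_pos _).le]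
  rw [lintegral_prod_eq_prod_lintegral_of_indepFun _ _ hind fun i ↦ by fun_prop,
    ENNReal.ofReal_prod_of_nonneg fun i _ ↦ by positivity]
  refine Finset.prod_congr rfl fun i _ ↦ ?_
  rw [← lintegral_exp_quadratic_gaussianReal (c i) (ha i)]
  exact (measurePreserving_eval (fun _ : ι ↦ gaussianReal 0 1) i).lintegral_comp
    (f := fun z ↦ ENNReal.ofReal (Real.exp (c i * z + a i * z ^ 2))) (by fun_prop)

/-- Every real matrix is, up to a rotation of its range, a matrix with orthogonal rows. -/
lemma exists_orthogonal_rows {m n : ℕ} (A : Matrix (Fin m) (Fin n) ℝ) :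
    ∃ (B : Matrix (Fin m) (Fin n) ℝ) (r : Fin m → ℝ),
      Bᵀ * B = Aᵀ * A ∧ B * Bᵀ = diagonal r := by
  have hA : (A * Aᵀ).IsHermitian := by
    simpa using Matrix.isHermitian_mul_conjTranspose_self A
  set U : Matrix (Fin m) (Fin m) ℝ := hA.eigenvectorUnitary.1
  have hUU : U * Uᵀ = 1 := by
    simpa [Matrix.star_eq_conjTranspose] using Unitary.coe_mul_star_self hA.eigenvectorUnitary
  refine ⟨Uᵀ * A, hA.eigenvalues, ?_, ?_⟩
  · rw [transpose_mul, transpose_transpose, Matrix.mul_assoc, ← Matrix.mul_assoc U, hUU,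
      Matrix.one_mul]
  · have h := hA.conjStarAlgAut_star_eigenvectorUnitary
    rw [Unitary.conjStarAlgAut_star_apply] at h
    simpa [Matrix.star_eq_conjTranspose, Matrix.mul_assoc] using h

lemma le_specNorm_of_mul_transpose_eq_diagonal {m n : ℕ} {B : Matrix (Fin m) (Fin n) ℝ}
    {r : Fin m → ℝ} (hB : B * Bᵀ = diagonal r) (i : Fin m) : r i ≤ specNorm (Bᵀ * B) := by
  set w : EuclideanSpace ℝ (Fin n) := WithLp.toLp 2 (Bᵀ *ᵥ Pi.single i 1) with hw
  have hwi : Matrix.toEuclideanCLM (𝕜 := ℝ) (Bᵀ * B) w = r i • w := by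
    rw [hw, Matrix.toEuclideanCLM_toLp, Matrix.mulVec_mulVec, Matrix.mul_assoc, hB,
      ← Matrix.mulVec_mulVec, Matrix.diagonal_mulVec_single, mul_one, ← WithLp.toLp_smul,
      ← Matrix.mulVec_smul, ← Pi.single_smul, smul_eq_mul, mul_one]
  have hle := (Matrix.toEuclideanCLM (𝕜 := ℝ) (Bᵀ * B)).le_opNorm w
  rw [hwi, norm_smul] at hle
  by_cases h0 : w = 0
  · have hr : r i = 0 := by
      have h1 : Bᵀ *ᵥ Pi.single i 1 = 0 := congrArg WithLp.ofLp h0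
      have h2 : (B * Bᵀ) *ᵥ Pi.single i 1 = 0 := by
        rw [← Matrix.mulVec_mulVec, h1, Matrix.mulVec_zero]
      rw [hB, Matrix.diagonal_mulVec_single] at h2
      simpa using congrFun h2 i
    rw [hr]
    exact norm_nonneg _
  · exact (le_abs_self _).trans (le_of_mul_le_mul_right hle (norm_pos_iff.2 h0))

lemma sum_mulVec_sq_eq_trace {m n : ℕ} (A : Matrix (Fin m) (Fin n) ℝ) (v : Fin n → ℝ) :
    ∑ i, (A *ᵥ v) i ^ 2 = ((Aᵀ * A) * vecMulVec v v).trace := by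
  rw [Matrix.mul_vecMulVec, Matrix.trace_vecMulVec, ← Matrix.mulVec_mulVec, dotProduct_comm,
    Matrix.dotProduct_mulVec, Matrix.vecMul_transpose]
  simp [dotProduct, sq]

/-- Decoupling with an independent standard Gaussian vector bounds the moment generating function
of the quadratic form. -/
lemma lintegral_exp_sum_mulVec_sq_le
    {Ω : Type*} [MeasurableSpace Ω] (P : Measure Ω) [IsProbabilityMeasure P]
    {m n : ℕ} {B : Matrix (Fin m) (Fin n) ℝ} {r : Fin m → ℝ} (hB : B * Bᵀ = diagonal r)
    {x : Ω → (Fin n → ℝ)} (hx : Measurable x) (μ : Fin n → ℝ) (σ : ℝ)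
    (hmgf : ∀ α : Fin n → ℝ,
      ∫⁻ ω, ENNReal.ofReal (Real.exp (∑ i, α i * (x ω i - μ i))) ∂P ≤
        ENNReal.ofReal (Real.exp ((∑ i, α i ^ 2) * σ ^ 2 / 2)))
    (l : ℝ) (hl : ∀ i, 2 * (l ^ 2 * σ ^ 2 / 2 * r i) < 1) :
    ∫⁻ ω, ENNReal.ofReal (Real.exp (l ^ 2 / 2 * ∑ i, (B *ᵥ x ω) i ^ 2)) ∂P ≤
      ENNReal.ofReal (∏ i, (√(1 - 2 * (l ^ 2 * σ ^ 2 / 2 * r i)))⁻¹ *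
        Real.exp ((l * (B *ᵥ μ) i) ^ 2 / (2 * (1 - 2 * (l ^ 2 * σ ^ 2 / 2 * r i))))) := by
  have hm : ∀ i, Measurable fun ω ↦ (B *ᵥ x ω) i := fun i ↦ by
    simp only [Matrix.mulVec, dotProduct]
    fun_prop
  calc
    _ = ∫⁻ ω, ∫⁻ z, ENNReal.ofReal (Real.exp (∑ i, (l * (B *ᵥ x ω) i) * z i))
          ∂Measure.pi (fun _ : Fin m ↦ gaussianReal 0 1) ∂P := by
      refine lintegral_congr fun ω ↦ ?_
      have h := lintegral_exp_quadratic_pi_gaussianReal (fun i ↦ l * (B *ᵥ x ω) i)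
        (fun _ ↦ 0) (by simp)
      simp only [zero_mul, add_zero, mul_zero, sub_zero, Real.sqrt_one, inv_one, one_mul,
        mul_one, ← Real.exp_sum] at h
      rw [h, Finset.mul_sum]
      exact congrArg (fun y ↦ ENNReal.ofReal (Real.exp y))
        (Finset.sum_congr rfl fun i _ ↦ by ring)
    _ = ∫⁻ z, ∫⁻ ω, ENNReal.ofReal (Real.exp (∑ i, (l * (B *ᵥ x ω) i) * z i)) ∂P
          ∂Measure.pi (fun _ : Fin m ↦ gaussianReal 0 1) := by
      refine lintegral_lintegral_swap (Measurable.aemeasurable ?_)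
      have hm' : ∀ i, Measurable fun p : Ω × (Fin m → ℝ) ↦ (B *ᵥ x p.1) i :=
        fun i ↦ (hm i).comp measurable_fst
      unfold Function.uncurry
      fun_prop
    _ ≤ ∫⁻ z, ENNReal.ofReal (Real.exp (∑ i, ((l * (B *ᵥ μ) i) * z i +
            (l ^ 2 * σ ^ 2 / 2 * r i) * z i ^ 2)))
          ∂Measure.pi (fun _ : Fin m ↦ gaussianReal 0 1) := by
      refine lintegral_mono fun z ↦ ?_
      have hlin : ∀ y : Fin n → ℝ, ∑ i, (l * (B *ᵥ y) i) * z i = l * ((Bᵀ *ᵥ z) ⬝ᵥ y) := by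
        intro y
        rw [Matrix.mulVec_transpose, ← Matrix.dotProduct_mulVec, dotProduct, Finset.mul_sum]
        exact Finset.sum_congr rfl fun i _ ↦ by ring
      have hsq : ∑ j, (l * (Bᵀ *ᵥ z) j) ^ 2 = l ^ 2 * ∑ i, r i * z i ^ 2 := by
        simp_rw [mul_pow, ← Finset.mul_sum]
        rw [sum_mulVec_sq_eq_trace, transpose_transpose, hB, Matrix.mul_vecMulVec,
          Matrix.trace_vecMulVec]
        simp only [dotProduct, Matrix.mulVec_diagonal]
        congr 1
        exact Finset.sum_congr rfl fun i _ ↦ by ring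
      have hsplit : ∀ ω, ∑ i, (l * (B *ᵥ x ω) i) * z i = ∑ i, (l * (B *ᵥ μ) i) * z i +
          ∑ j, (l * (Bᵀ *ᵥ z) j) * (x ω j - μ j) := by
        intro ω
        rw [hlin, hlin]
        simp only [dotProduct, Finset.mul_sum, ← Finset.sum_add_distrib]
        exact Finset.sum_congr rfl fun i _ ↦ by ring
      simp_rw [hsplit, Real.exp_add, ENNReal.ofReal_mul (Real.exp_pos _).le]
      rw [lintegral_const_mul _ (by fun_prop)]
      refine (mul_le_mul_right (hmgf fun j ↦ l * (Bᵀ *ᵥ z) j) _).trans_eq ?_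
      rw [← ENNReal.ofReal_mul (Real.exp_pos _).le, ← Real.exp_add, hsq]
      congr 2
      rw [Finset.sum_add_distrib, Finset.mul_sum, Finset.sum_mul, Finset.sum_div]
      congr 1
      exact Finset.sum_congr rfl fun i _ ↦ by ring
    _ = _ := lintegral_exp_quadratic_pi_gaussianReal _ _ hl

lemma measure_lt_le_of_forall_pos_add {Ω : Type*} [MeasurableSpace Ω] (P : Measure Ω)
    {u : Ω → ℝ} {K : ℝ} {c : ℝ≥0∞} (h : ∀ ε > 0, P {ω | K + ε < u ω} ≤ c) :
    P {ω | K < u ω} ≤ c := by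
  have hU : {ω | K < u ω} = ⋃ k : ℕ, {ω | K + 1 / ((k : ℝ) + 1) < u ω} := by
    ext ω
    simp only [Set.mem_ofPred_eq, Set.mem_iUnion]
    refine ⟨fun hω ↦ ?_, fun ⟨k, hk⟩ ↦ ?_⟩
    · obtain ⟨k, hk⟩ := exists_nat_one_div_lt (sub_pos.2 hω)
      exact ⟨k, by linarith⟩
    · have : (0 : ℝ) < 1 / ((k : ℝ) + 1) := by positivity
      linarith
  have hmono : Monotone fun k : ℕ ↦ {ω | K + 1 / ((k : ℝ) + 1) < u ω} := by
    intro j k hjk ω hω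
    have : 1 / ((k : ℝ) + 1) ≤ 1 / ((j : ℝ) + 1) := Nat.one_div_le_one_div hjk
    simp only [Set.mem_ofPred_eq] at hω ⊢
    linarith
  rw [hU, hmono.measure_iUnion]
  exact iSup_le fun k ↦ h _ (by positivity)

/-- The tail bound for a matrix with orthogonal rows, with the deviation level `s` as a free
parameter. -/
lemma measure_lt_sum_mulVec_sq_le_of_pos
    {Ω : Type*} [MeasurableSpace Ω] (P : Measure Ω) [IsProbabilityMeasure P]
    {m n : ℕ} {B : Matrix (Fin m) (Fin n) ℝ} {r : Fin m → ℝ} (hB : B * Bᵀ = diagonal r)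
    {x : Ω → (Fin n → ℝ)} (hx : Measurable x) (μ : Fin n → ℝ) {σ : ℝ} (hσ : 0 < σ)
    (hmgf : ∀ α : Fin n → ℝ,
      ∫⁻ ω, ENNReal.ofReal (Real.exp (∑ i, α i * (x ω i - μ i))) ∂P ≤
        ENNReal.ofReal (Real.exp ((∑ i, α i ^ 2) * σ ^ 2 / 2)))
    (hr : ∀ i, 0 ≤ r i) {ρ s : ℝ} (hρ : 0 ≤ ρ) (hrρ : ∀ i, r i ≤ ρ) (hs : 0 ≤ s) :
    P {ω | σ ^ 2 * (∑ i, r i + 2 * (s * ∑ i, r i ^ 2) + 2 * ρ * (s ^ 2 * ∑ i, r i ^ 2)) +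
          (∑ i, (B *ᵥ μ) i ^ 2) * (1 + 2 * (ρ * s)) < ∑ i, (B *ᵥ x ω) i ^ 2} ≤
      ENNReal.ofReal (Real.exp (-(s ^ 2 * ∑ i, r i ^ 2))) := by
  set K := σ ^ 2 * (∑ i, r i + 2 * (s * ∑ i, r i ^ 2) + 2 * ρ * (s ^ 2 * ∑ i, r i ^ 2)) +
    (∑ i, (B *ᵥ μ) i ^ 2) * (1 + 2 * (ρ * s)) with hK
  have hD : 0 < 1 + 2 * (ρ * s) := by positivity
  set D := 1 + 2 * (ρ * s) with hDdef
  obtain ⟨γ, hγ⟩ : ∃ γ, γ = s / D := ⟨_, rfl⟩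
  have hγ0 : 0 ≤ γ := hγ ▸ by positivity
  have hγD : γ * D = s := by rw [hγ]; field_simp
  obtain ⟨l, hl⟩ : ∃ l, l ^ 2 = 2 * γ / σ ^ 2 := ⟨√(2 * γ / σ ^ 2), Real.sq_sqrt (by positivity)⟩
  have hlσ : l ^ 2 * σ ^ 2 / 2 = γ := by rw [hl]; field_simp
  have hDq : D * (1 - 2 * (γ * ρ)) = 1 := by
    linear_combination hDdef - 2 * ρ * hγD
  have hq : 0 < 1 - 2 * (γ * ρ) := pos_of_mul_pos_right (hDq.symm ▸ one_pos) hD.le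
  have hqr : ∀ i, 1 - 2 * (γ * ρ) ≤ 1 - 2 * (γ * r i) := fun i ↦ by
    have := mul_le_mul_of_nonneg_left (hrρ i) hγ0
    linarith
  have hqi : ∀ i, (1 - 2 * (γ * r i))⁻¹ ≤ D := fun i ↦ by
    rw [eq_inv_of_mul_eq_one_left hDq]
    exact inv_anti₀ hq (hqr i)
  have hexp := lintegral_exp_sum_mulVec_sq_le P hB hx μ σ hmgf l fun i ↦ by
    rw [hlσ]
    linarith [hqr i]
  rw [hlσ] at hexp
  have hprod : ∏ i, (√(1 - 2 * (γ * r i)))⁻¹ *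
        Real.exp ((l * (B *ᵥ μ) i) ^ 2 / (2 * (1 - 2 * (γ * r i)))) ≤
      Real.exp (γ * ∑ i, r i + γ ^ 2 * D * ∑ i, r i ^ 2 +
        l ^ 2 / 2 * D * ∑ i, (B *ᵥ μ) i ^ 2) := by
    rw [Finset.mul_sum, Finset.mul_sum, Finset.mul_sum, ← Finset.sum_add_distrib,
      ← Finset.sum_add_distrib, Real.exp_sum]
    refine Finset.prod_le_prod (fun i _ ↦ by positivity) fun i _ ↦ ?_
    rw [Real.exp_add]
    refine mul_le_mul ((inv_sqrt_one_sub_le_exp (mul_nonneg hγ0 (hr i)) (by linarith [hqr i])).trans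
      (Real.exp_le_exp.2 ?_)) (Real.exp_le_exp.2 ?_) (Real.exp_pos _).le (Real.exp_pos _).le
    · rw [div_eq_mul_inv]
      have := mul_le_mul_of_nonneg_left (hqi i) (sq_nonneg (γ * r i))
      linarith
    · rw [div_eq_mul_inv, mul_inv]
      have := mul_le_mul_of_nonneg_left (hqi i) (sq_nonneg (l * (B *ᵥ μ) i))
      linarith
  have hm : ∀ i, Measurable fun ω ↦ (B *ᵥ x ω) i := fun i ↦ by
    simp only [Matrix.mulVec, dotProduct]
    fun_prop
  calc
    _ ≤ ∫⁻ ω, ENNReal.ofReal (Real.exp (-(l ^ 2 / 2 * K))) *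
          ENNReal.ofReal (Real.exp (l ^ 2 / 2 * ∑ i, (B *ᵥ x ω) i ^ 2)) ∂P := by
      refine meas_le_lintegral₀ (by fun_prop) fun ω hω ↦ ?_
      rw [← ENNReal.ofReal_mul (Real.exp_pos _).le, ← Real.exp_add, ENNReal.one_le_ofReal,
        Real.one_le_exp_iff]
      have := mul_le_mul_of_nonneg_left (le_of_lt hω) (by positivity : 0 ≤ l ^ 2 / 2)
      linarith
    _ ≤ ENNReal.ofReal (Real.exp (-(l ^ 2 / 2 * K)) *
          Real.exp (γ * ∑ i, r i + γ ^ 2 * D * ∑ i, r i ^ 2 +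
            l ^ 2 / 2 * D * ∑ i, (B *ᵥ μ) i ^ 2)) := by
      rw [lintegral_const_mul _ (by fun_prop), ENNReal.ofReal_mul (Real.exp_pos _).le]
      exact mul_le_mul_right (hexp.trans (ENNReal.ofReal_le_ofReal hprod)) _
    _ = _ := by
      rw [← Real.exp_add]
      congr 2
      rw [hK]
      generalize ∑ i, r i = T₁
      generalize ∑ i, r i ^ 2 = T₂
      generalize ∑ i, (B *ᵥ μ) i ^ 2 = V
      linear_combination (-(T₁ + 2 * (s * T₂) + 2 * ρ * (s ^ 2 * T₂))) * hlσ +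
        (γ * T₂ - s * T₂) * hγD + γ * s * T₂ * hDdef

lemma measure_lt_sum_mulVec_sq_le
    {Ω : Type*} [MeasurableSpace Ω] (P : Measure Ω) [IsProbabilityMeasure P]
    {m n : ℕ} {B : Matrix (Fin m) (Fin n) ℝ} {r : Fin m → ℝ} (hB : B * Bᵀ = diagonal r)
    {x : Ω → (Fin n → ℝ)} (hx : Measurable x) (μ : Fin n → ℝ) {σ : ℝ}
    (hmgf : ∀ α : Fin n → ℝ,
      ∫⁻ ω, ENNReal.ofReal (Real.exp (∑ i, α i * (x ω i - μ i))) ∂P ≤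
        ENNReal.ofReal (Real.exp ((∑ i, α i ^ 2) * σ ^ 2 / 2)))
    (hr : ∀ i, 0 ≤ r i) {ρ s : ℝ} (hρ : 0 ≤ ρ) (hrρ : ∀ i, r i ≤ ρ) (hs : 0 ≤ s) :
    P {ω | σ ^ 2 * (∑ i, r i + 2 * (s * ∑ i, r i ^ 2) + 2 * ρ * (s ^ 2 * ∑ i, r i ^ 2)) +
          (∑ i, (B *ᵥ μ) i ^ 2) * (1 + 2 * (ρ * s)) < ∑ i, (B *ᵥ x ω) i ^ 2} ≤
      ENNReal.ofReal (Real.exp (-(s ^ 2 * ∑ i, r i ^ 2))) := by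
  refine measure_lt_le_of_forall_pos_add P fun ε hε ↦ ?_
  have hT : 0 ≤ ∑ i, r i + 2 * (s * ∑ i, r i ^ 2) + 2 * ρ * (s ^ 2 * ∑ i, r i ^ 2) := by
    have := Finset.sum_nonneg fun i (_ : i ∈ Finset.univ) ↦ hr i
    positivity
  set T := ∑ i, r i + 2 * (s * ∑ i, r i ^ 2) + 2 * ρ * (s ^ 2 * ∑ i, r i ^ 2)
  have hpos : 0 < σ ^ 2 + ε / (T + 1) := by positivity
  have hτ : √(σ ^ 2 + ε / (T + 1)) ^ 2 = σ ^ 2 + ε / (T + 1) := Real.sq_sqrt hpos.le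
  have hστ : σ ^ 2 ≤ √(σ ^ 2 + ε / (T + 1)) ^ 2 := by
    rw [hτ]
    exact le_add_of_nonneg_right (by positivity)
  refine (measure_mono fun ω hω ↦ ?_).trans (measure_lt_sum_mulVec_sq_le_of_pos P hB hx μ
    (Real.sqrt_pos.2 hpos) (fun α ↦ (hmgf α).trans ?_) hr hρ hrρ hs)
  · have hεT : ε / (T + 1) * T ≤ ε := by
      rw [div_mul_eq_mul_div, div_le_iff₀ (by positivity)]
      linarith
    simp only [Set.mem_ofPred_eq] at hω ⊢
    rw [hτ]
    linarith
  · gcongr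

/-- **Lemma C.6 (Bernstein's inequality for sub-Gaussian vectors in quadratic
form; Hsu–Kakade–Zhang).** Let `Σ = AᵀA`. If the random vector `x` satisfies the
sub-Gaussian moment generating function bound
`E[exp(αᵀ(x − μ))] ≤ exp(‖α‖₂² σ²/2)` for all `α`, then for any `t > 0`,
`P[‖Ax‖² > σ²(tr Σ + 2√(tr(Σ²) t) + 2‖Σ‖₂ t)
      + tr(Σμμᵀ)(1 + 2√(‖Σ‖₂² t / tr(Σ²)))] ≤ e^{−t}`. -/
theorem bernstein_subgaussian_quadratic_form
    {Ω : Type*} [MeasurableSpace Ω] (P : Measure Ω) [IsProbabilityMeasure P]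
    (m n : ℕ) (A : Matrix (Fin m) (Fin n) ℝ)
    (x : Ω → (Fin n → ℝ)) (hx : Measurable x)
    (μ : Fin n → ℝ) (σ : ℝ) (hσ : 0 ≤ σ)
    (hmgf : ∀ α : Fin n → ℝ,
      ∫⁻ ω, ENNReal.ofReal (Real.exp (∑ i, α i * (x ω i - μ i))) ∂P ≤
        ENNReal.ofReal (Real.exp ((∑ i, α i ^ 2) * σ ^ 2 / 2)))
    (t : ℝ) (ht : 0 < t) :
    P {ω | σ ^ 2 * ((Aᵀ * A).trace
            + 2 * Real.sqrt (((Aᵀ * A) * (Aᵀ * A)).trace * t)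
            + 2 * specNorm (Aᵀ * A) * t)
          + ((Aᵀ * A) * Matrix.vecMulVec μ μ).trace *
              (1 + 2 * Real.sqrt ((specNorm (Aᵀ * A)) ^ 2 * t / ((Aᵀ * A) * (Aᵀ * A)).trace))
        < ∑ i, (A.mulVec (x ω) i) ^ 2} ≤
      ENNReal.ofReal (Real.exp (-t)) := by
  obtain ⟨B, r, hBA, hB⟩ := exists_orthogonal_rows A
  have hr2 : ∀ i, r i = ∑ j, B i j ^ 2 := fun i ↦ by
    rw [← Matrix.diagonal_apply_eq r i, ← hB, Matrix.mul_apply]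
    exact Finset.sum_congr rfl fun j _ ↦ by rw [transpose_apply, sq]
  have hr : ∀ i, 0 ≤ r i := fun i ↦ hr2 i ▸ Finset.sum_nonneg fun j _ ↦ sq_nonneg _
  have htr : (Bᵀ * B).trace = ∑ i, r i := by
    rw [Matrix.trace_mul_comm, hB, Matrix.trace_diagonal]
  have htr2 : ((Bᵀ * B) * (Bᵀ * B)).trace = ∑ i, r i ^ 2 := by
    rw [Matrix.mul_assoc, Matrix.trace_mul_comm, Matrix.mul_assoc, Matrix.mul_assoc, hB,
      ← Matrix.mul_assoc, hB, Matrix.diagonal_mul_diagonal, Matrix.trace_diagonal]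
    exact Finset.sum_congr rfl fun i _ ↦ (sq _).symm
  have hρ : 0 ≤ specNorm (Bᵀ * B) := norm_nonneg _
  simp only [sum_mulVec_sq_eq_trace A, ← hBA]
  simp only [← sum_mulVec_sq_eq_trace B, htr, htr2]
  rcases (Finset.sum_nonneg fun i _ ↦ sq_nonneg (r i) : 0 ≤ ∑ i, r i ^ 2).eq_or_lt with h0 | hT
  · have hr0 : ∀ i, r i = 0 := fun i ↦ by
      simpa using (Finset.sum_eq_zero_iff_of_nonneg fun i _ ↦ sq_nonneg (r i)).1 h0.symm i
        (Finset.mem_univ i)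
    have hB0 : B = 0 := by
      ext i j
      simpa using (Finset.sum_eq_zero_iff_of_nonneg fun j _ ↦ sq_nonneg (B i j)).1
        ((hr2 i).symm.trans (hr0 i)) j (Finset.mem_univ j)
    simp [hB0, hr0, specNorm]
  · set T := ∑ i, r i ^ 2
    have hs2 : √(t / T) ^ 2 * T = t := by
      rw [Real.sq_sqrt (by positivity)]
      field_simp
    have h1 : √(T * t) = √(t / T) * T := by
      rw [Real.sqrt_eq_iff_mul_self_eq (by positivity) (by positivity)]
      linear_combination -T * hs2
    have h2 : √(specNorm (Bᵀ * B) ^ 2 * t / T) = specNorm (Bᵀ * B) * √(t / T) := by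
      rw [mul_div_assoc, Real.sqrt_mul (sq_nonneg _), Real.sqrt_sq hρ]
    have h := measure_lt_sum_mulVec_sq_le P hB hx μ hmgf hr hρ
      (le_specNorm_of_mul_transpose_eq_diagonal hB) (Real.sqrt_nonneg (t / T))
    rw [hs2] at h
    rwa [h1, h2]
end
end

section
/- Cone condition for the ℓ₁-regularized error (intermediate claim in the proof of Theorem 3.9): Let ℒ : ℝ^d → ℝ be differentiable at θ* ∈ ℝ^d, let β > 0, and let θ̂ ∈ ℝ^d satisfy (i) ℒ(θ̂) − ℒ(θ*) − ⟨∇ℒ(θ*), θ̂ − θ*⟩ ≥ 0, (ii) ℒ(θ̂) + β‖θ̂‖₁ ≤ ℒ(θ*) + β‖θ*‖₁, and (iii) ‖∇ℒ(θ*)‖_∞ ≤ β/2. Then, with S the support of θ*, the error Δ = θ̂ − θ* satisfies ‖Δ_{S^c}‖₁ ≤ 3‖Δ_S‖₁. -/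
open Finset
open scoped RealInnerProductSpace

noncomputable section

/-- If `β ∑ |bⱼ| ≤ β ∑ |aⱼ| - ∑ (bⱼ - aⱼ) gⱼ` and `g` is bounded by `β / 2` in every coordinate,
then `b - a` lies in the cone `‖Δ_{Sᶜ}‖₁ ≤ 3 ‖Δ_S‖₁`, with `S` the support of `a`. -/
theorem sum_compl_support_abs_sub_le {ι : Type*} [Fintype ι] [DecidableEq ι] (a b g : ι → ℝ)
    {β : ℝ} (hβ : 0 < β) (hg : ∀ j, |g j| ≤ β / 2)
    (h : β * ∑ j, |b j| ≤ β * ∑ j, |a j| - ∑ j, (b j - a j) * g j) :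
    ∑ j ∈ (Finset.univ.filter fun j => a j ≠ 0)ᶜ, |b j - a j| ≤
      3 * ∑ j ∈ Finset.univ.filter (fun j => a j ≠ 0), |b j - a j| := by
  set S := Finset.univ.filter fun j => a j ≠ 0 with hS
  have hdual : -∑ j, (b j - a j) * g j ≤ β / 2 * ∑ j, |b j - a j| := by
    rw [← Finset.sum_neg_distrib, Finset.mul_sum]
    refine Finset.sum_le_sum fun j _ => ?_
    calc -((b j - a j) * g j) ≤ |(b j - a j) * g j| := neg_le_abs _
      _ = |g j| * |b j - a j| := by rw [abs_mul, mul_comm]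
      _ ≤ β / 2 * |b j - a j| := by gcongr; exact hg j
  have hl1 : ∑ j, |b j| - ∑ j, |a j| ≤ 1 / 2 * ∑ j, |b j - a j| := by
    refine le_of_mul_le_mul_left ?_ hβ
    linarith
  have hon : ∑ j ∈ S, |a j| ≤ ∑ j ∈ S, |b j| + ∑ j ∈ S, |b j - a j| := by
    rw [← Finset.sum_add_distrib]
    refine Finset.sum_le_sum fun j _ => ?_
    linarith [abs_sub_abs_le_abs_sub (a j) (b j), abs_sub_comm (a j) (b j)]
  have hzero : ∀ j ∈ Sᶜ, a j = 0 := fun j hj => by simpa [hS] using hj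
  have hoff : ∑ j ∈ Sᶜ, |b j - a j| = ∑ j ∈ Sᶜ, |b j| :=
    Finset.sum_congr rfl fun j hj => by rw [hzero j hj, sub_zero]
  have hoff' : ∑ j ∈ Sᶜ, |a j| = 0 :=
    Finset.sum_eq_zero fun j hj => by rw [hzero j hj, abs_zero]
  rw [← Finset.sum_add_sum_compl S fun j => |b j|, ← Finset.sum_add_sum_compl S fun j => |a j|,
    ← Finset.sum_add_sum_compl S fun j => |b j - a j|] at hl1
  linarith

/-- **Intermediate claim in the proof of Theorem 3.9 (cone condition for the
ℓ₁-regularized error).** If `ℒ` is differentiable at `θ*` with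
(i) `ℒ(θ̂) − ℒ(θ*) − ⟨∇ℒ(θ*), θ̂ − θ*⟩ ≥ 0`,
(ii) `ℒ(θ̂) + β‖θ̂‖₁ ≤ ℒ(θ*) + β‖θ*‖₁`, and
(iii) `‖∇ℒ(θ*)‖_∞ ≤ β/2`,
then the error `Δ = θ̂ − θ*` satisfies `‖Δ_{S^c}‖₁ ≤ 3‖Δ_S‖₁`, where `S` is the
support of `θ*`. -/
theorem cone_condition_l1_error (d : ℕ)
    (L : EuclideanSpace ℝ (Fin d) → ℝ)
    (θstar θhat : EuclideanSpace ℝ (Fin d)) (β : ℝ) (hβ : 0 < β)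
    (hdiff : DifferentiableAt ℝ L θstar)
    (h1 : 0 ≤ L θhat - L θstar - ⟪gradient L θstar, θhat - θstar⟫)
    (h2 : L θhat + β * ∑ j, |θhat j| ≤ L θstar + β * ∑ j, |θstar j|)
    (h3 : ∀ j, |gradient L θstar j| ≤ β / 2) :
    ∑ j ∈ (Finset.univ.filter fun j => θstar j ≠ 0)ᶜ, |θhat j - θstar j| ≤
      3 * ∑ j ∈ Finset.univ.filter (fun j => θstar j ≠ 0), |θhat j - θstar j| := by
  refine sum_compl_support_abs_sub_le θstar θhat (gradient L θstar).ofLp hβ h3 ?_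
  have hinner : ⟪gradient L θstar, θhat - θstar⟫ =
      ∑ j, (θhat j - θstar j) * gradient L θstar j := by
    rw [PiLp.inner_apply]; rfl
  linarith
end
end
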